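/- For every ε > 0 there exists a constant C = C(ε) > 0 with the following property. For every squarefree positive integer N, every positive divisor ℓ of N, every g ∈ SL₂(ℝ), every δ ∈ (0,1] and every L > 0, the set {(γ₁, γ₂) : γ₁, γ₂ ∈ R(ℓ;g) ∩ Ω⋆(δ,L) and det(γ₁) = det(γ₂)} is finite and has cardinality at most C·(N(1+L))^ε · ℓL² · (1 + ℓ^{1/2}·H(g)·δ^{1/2} + ℓ^{1/2}·H(g)·δ·L + (ℓ²/N)·δ·L²) · (1 + ℓ^{1/2}·H(g)·δ^{1/2} + ℓ^{1/2}·H(g)·δ^{1/2}·L + (ℓ²/N)·δ·L²). -/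

import Mathlib

open MeasureTheory Real Matrix Set

noncomputable section

/-- 2×2 real matrices. -/
abbrev M2 := Matrix (Fin 2) (Fin 2) ℝ

/-- The lattice R(ℓ) = { (a, b; c, d) : a, d ∈ ℤ, b ∈ (1/ℓ)ℤ, c ∈ (N/ℓ)ℤ }. -/
def Rlat (N ℓ : ℕ) : Set M2 :=
  {γ | (∃ n : ℤ, γ 0 0 = (n : ℝ)) ∧ (∃ n : ℤ, γ 0 1 = (n : ℝ) / ℓ) ∧
       (∃ n : ℤ, γ 1 0 = (n : ℝ) * N / ℓ) ∧ (∃ n : ℤ, γ 1 1 = (n : ℝ))}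

/-- The conjugated lattice R(ℓ;g) = g⁻¹ · R(ℓ) · g. -/
def Rconj (N ℓ : ℕ) (g : M2) : Set M2 := {γ | g * γ * g⁻¹ ∈ Rlat N ℓ}

/-- P(γ): half the sum of the squares of the four entries of γ. -/
def Pfun (γ : M2) : ℝ := ((γ 0 0) ^ 2 + (γ 0 1) ^ 2 + (γ 1 0) ^ 2 + (γ 1 1) ^ 2) / 2

/-- Ω(δ,L) = {γ : P(γ) ≤ L² and P(γ) − det γ ≤ 2δL²}. -/
def OmegaSet (δ L : ℝ) : Set M2 := {γ | Pfun γ ≤ L ^ 2 ∧ Pfun γ - γ.det ≤ 2 * δ * L ^ 2}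

/-- Ω⋆(δ,L): nonzero elements of Ω(δ,L). -/
def OmegaStar (δ L : ℝ) : Set M2 := {γ | γ ∈ OmegaSet δ L ∧ γ ≠ 0}

/-- Ψ(δ,L) = {γ : P(γ) ≤ L² and P(γ) + det γ ≤ 2δL²}. -/
def PsiSet (δ L : ℝ) : Set M2 := {γ | Pfun γ ≤ L ^ 2 ∧ Pfun γ + γ.det ≤ 2 * δ * L ^ 2}

/-- Ψ⋆(δ,L): nonzero elements of Ψ(δ,L). -/
def PsiStar (δ L : ℝ) : Set M2 := {γ | γ ∈ PsiSet δ L ∧ γ ≠ 0}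

/-- Möbius action of a 2×2 real matrix on a complex number. -/
def moebius (m : M2) (z : ℂ) : ℂ :=
  ((m 0 0 : ℂ) * z + (m 0 1 : ℂ)) / ((m 1 0 : ℂ) * z + (m 1 1 : ℂ))

/-- A₀(N): determinant-one matrices of the form Q^{−1/2}·(Qa, b; Nc, Qd)
    with Q a positive divisor of N and a,b,c,d ∈ ℤ. -/
def AtkinLehner (N : ℕ) : Set M2 :=
  {σ | σ.det = 1 ∧ ∃ (Q : ℕ) (a b c d : ℤ), 0 < Q ∧ Q ∣ N ∧
     σ = (Real.sqrt Q)⁻¹ • !![(Q : ℝ) * a, (b : ℝ); (N : ℝ) * c, (Q : ℝ) * d]}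

/-- H(g) = sup_{σ ∈ A₀(N)} Im(σ·(g·i)). -/
def Hgt (N : ℕ) (g : M2) : ℝ :=
  sSup ((fun σ => (moebius σ (moebius g Complex.I)).im) '' AtkinLehner N)

/-- Divisor bound. -/
lemma kk_divisor_bound (η : ℝ) (hη : 0 < η) : ∃ C : ℝ, 1 ≤ C ∧ ∀ n : ℕ, n ≠ 0 →
    (n.divisors.card : ℝ) ≤ C * (n : ℝ) ^ η := by
  set c : ℝ := max 1 (1 / (η * Real.log 2)) with hc
  have hl2 : 0 < Real.log 2 := Real.log_pos (by norm_num)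
  have hc1 : 1 ≤ c := le_max_left _ _
  have hc2 : 1 ≤ c * (η * Real.log 2) := by
    have h := le_max_right 1 (1 / (η * Real.log 2))
    have hp : 0 < η * Real.log 2 := by positivity
    calc (1:ℝ) = 1 / (η * Real.log 2) * (η * Real.log 2) := by field_simp
      _ ≤ _ := by gcongr
  obtain ⟨B, hB⟩ := exists_nat_ge ((2:ℝ) ^ (1 / η))
  refine ⟨c ^ B, one_le_pow₀ hc1, fun n hn => ?_⟩
  have h1 : ((n.divisors.card : ℕ) : ℝ) = ∏ p ∈ n.primeFactors, ((n.factorization p : ℝ) + 1) := by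
    rw [Nat.card_divisors hn]; push_cast; rfl
  have h2 : (n : ℝ) ^ η = ∏ p ∈ n.primeFactors, ((p : ℝ) ^ η) ^ (n.factorization p) := by
    conv_lhs => rw [← Nat.prod_factorization_pow_eq_self hn]
    rw [Finsupp.prod, Nat.support_factorization]
    push_cast
    rw [← Real.finsetProd_rpow _ _ (fun i _ => by positivity)]
    refine Finset.prod_congr rfl fun p _ => ?_
    rw [← Real.rpow_natCast, ← Real.rpow_natCast, ← Real.rpow_mul (by positivity), ← Real.rpow_mul (by positivity), mul_comm]
  have h3 : ∏ p ∈ n.primeFactors, (if p < B then c else 1) ≤ c ^ B := by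
    rw [Finset.prod_ite]
    simp only [Finset.prod_const, one_pow, mul_one]
    refine pow_le_pow_right₀ hc1 ?_
    calc _ ≤ (Finset.range B).card := Finset.card_le_card (fun p hp => by
            simp only [Finset.mem_filter] at hp; simpa using hp.2)
      _ = B := Finset.card_range B
  have h4 : ∏ p ∈ n.primeFactors, ((n.factorization p : ℝ) + 1) ≤
      ∏ p ∈ n.primeFactors, ((if p < B then c else 1) * ((p : ℝ) ^ η) ^ (n.factorization p)) := by
    refine Finset.prod_le_prod (fun p _ => by positivity) fun p hp => ?_
    have hpp := Nat.prime_of_mem_primeFactors hp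
    have hp2 : (2:ℝ) ≤ p := by exact_mod_cast hpp.two_le
    set k := n.factorization p
    split_ifs with h
    · have e1 : (2:ℝ) ^ η ≤ (p:ℝ) ^ η := Real.rpow_le_rpow (by norm_num) hp2 hη.le
      have e2 : 1 + η * Real.log 2 ≤ (2:ℝ)^η := by
        rw [Real.rpow_def_of_pos (by norm_num)]
        have := Real.add_one_le_exp (Real.log 2 * η); linarith
      have e3 : 1 + (k:ℝ) * (η * Real.log 2) ≤ ((p:ℝ)^η)^k := by
        have := one_add_mul_le_pow (a := η * Real.log 2) (by nlinarith [mul_pos hη hl2]) k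
        refine this.trans ?_
        gcongr
        linarith
      calc (k:ℝ) + 1 ≤ c * (1 + (k:ℝ) * (η * Real.log 2)) := by
            have : (0:ℝ) ≤ k := by positivity
            nlinarith
        _ ≤ _ := by gcongr
    · have e0 : (2:ℝ)^(1/η) ≤ p := hB.trans (by exact_mod_cast (not_lt.mp h))
      have e1 : (2:ℝ) ≤ (p:ℝ)^η := by
        calc (2:ℝ) = ((2:ℝ)^(1/η))^η := by
              rw [← Real.rpow_mul (by norm_num), one_div, inv_mul_cancel₀ hη.ne', Real.rpow_one]
          _ ≤ _ := Real.rpow_le_rpow (by positivity) e0 hη.le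
      rw [one_mul]
      have e3 := one_add_mul_le_pow (a := (1:ℝ)) (by norm_num) k
      calc (k:ℝ) + 1 ≤ (1+1)^k := by linarith
        _ ≤ _ := by gcongr; linarith
  rw [h1, h2]
  refine h4.trans ?_
  rw [Finset.prod_mul_distrib]
  gcongr

/-- Counting points of a lattice in a parallelepiped. -/
lemma kk_index (A : Matrix (Fin 3) (Fin 3) ℤ) (hA : A.det ≠ 0) (S : Finset (Fin 3 → ℤ))
    (hS : ∀ s ∈ S, ∃ x : Fin 3 → ℝ, (∀ i, |x i| ≤ 1) ∧ ∀ i, (s i : ℝ) = ∑ j, (A i j : ℝ) * x j) :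
    S.card ≤ 125 * A.det.natAbs := by
  classical
  have hinj : Function.Injective (Matrix.mulVecLin A) := by
    intro u v h
    exact Matrix.mulVec_injective_of_det_ne_zero hA h
  let f := Matrix.mulVecLin A
  let Nn := LinearMap.range f
  let e := LinearEquiv.ofInjective f hinj
  let bN : Module.Basis (Fin 3) ℤ Nn := (Pi.basisFun ℤ (Fin 3)).map e
  have hidx := Submodule.natAbs_det_basis_change (Pi.basisFun ℤ (Fin 3)) Nn bN
  have hdet : (Pi.basisFun ℤ (Fin 3)).det ((↑) ∘ bN) = A.det := by
    rw [Module.Basis.det_apply, ]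
    congr 1
    ext i j
    have : ((LinearEquiv.ofInjective A.mulVecLin hinj) (Pi.single j 1) : Fin 3 → ℤ) = A.mulVecLin (Pi.single j 1) := rfl
    simp only [Module.Basis.toMatrix_apply, bN, e, f, Function.comp, Module.Basis.map_apply, Pi.basisFun_apply, Pi.basisFun_repr]
    rw [this]
    simp
  rw [hdet] at hidx
  have hfin : Finite ((Fin 3 → ℤ) ⧸ Nn) := by
    apply Nat.finite_of_card_ne_zero
    change Nat.card ((Fin 3 → ℤ) ⧸ Nn) ≠ 0
    rw [← hidx]; simpa using hA
  have := Fintype.ofFinite ((Fin 3 → ℤ) ⧸ Nn)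
  have hcard : (Finset.univ : Finset ((Fin 3 → ℤ) ⧸ Nn)).card = A.det.natAbs := by
    rw [hidx, Nat.card_eq_fintype_card]; rfl
  rw [← hcard]
  refine Finset.card_le_mul_card_image_of_maps_to (f := fun s => Submodule.Quotient.mk (p := Nn) s) (fun s _ => Finset.mem_univ _) 125 ?_
  intro cl _
  rcases (S.filter (fun s => Submodule.Quotient.mk (p := Nn) s = cl)).eq_empty_or_nonempty with h0 | ⟨s0, hs0⟩
  · simp [h0]
  have hex : ∀ s ∈ S.filter (fun s => Submodule.Quotient.mk (p := Nn) s = cl), ∃ t : Fin 3 → ℤ,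
      s = s0 + A.mulVec t ∧ ∀ i, t i ∈ Finset.Icc (-2 : ℤ) 2 := by
    intro s hs
    simp only [Finset.mem_filter] at hs hs0
    have hq := hs.2.trans hs0.2.symm
    rw [Submodule.Quotient.eq] at hq
    obtain ⟨t, ht⟩ := hq
    refine ⟨t, by rw [show A.mulVec t = s - s0 from ht]; abel, fun i => ?_⟩
    obtain ⟨x, hx, hxs⟩ := hS s hs.1
    obtain ⟨x0, hx0, hxs0⟩ := hS s0 hs0.1
    have hAR : (A.map (Int.castRingHom ℝ)).det ≠ 0 := by
      rw [← RingHom.mapMatrix_apply, ← RingHom.map_det]; simpa using hA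
    have key : (fun i => (t i : ℝ)) = x - x0 := by
      apply Matrix.mulVec_injective_of_det_ne_zero hAR
      ext i
      have h1 := congrFun ht i
      have h2 : ((∑ j, A i j * t j : ℤ) : ℝ) = s i - s0 i := by
        have : (∑ j, A i j * t j) = s i - s0 i := by simpa [f, Matrix.mulVec, dotProduct] using h1
        rw [this]; push_cast; rfl
      simp only [Matrix.mulVec, dotProduct, Matrix.map_apply, Int.coe_castRingHom, Pi.sub_apply, mul_sub, Finset.sum_sub_distrib]
      rw [← hxs, ← hxs0, ← h2]; push_cast; rfl
    have k1 : (t i : ℝ) = x i - x0 i := congrFun key i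
    have := abs_le.mp (hx i); have := abs_le.mp (hx0 i)
    rw [Finset.mem_Icc]
    constructor
    · have : (-2:ℝ) ≤ t i := by linarith
      exact_mod_cast this
    · have : (t i:ℝ) ≤ 2 := by linarith
      exact_mod_cast this
  choose! t ht1 ht2 using hex
  calc _ ≤ (Fintype.piFinset (fun _ : Fin 3 => Finset.Icc (-2 : ℤ) 2)).card := by
        refine Finset.card_le_card_of_injOn t (fun s hs => ?_) (fun s hs s' hs' h => ?_)
        · rw [Finset.mem_coe, Fintype.mem_piFinset]; exact ht2 s hs
        · rw [ht1 s hs, ht1 s' hs', h]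
    _ ≤ 125 := by simp

lemma kk_den_pos (g : M2) (hg : g.det = 1) : 0 < g 1 0 ^ 2 + g 1 1 ^ 2 := by
  rw [Matrix.det_fin_two] at hg
  by_contra h
  have h1 : g 1 0 = 0 := by nlinarith [sq_nonneg (g 1 0), sq_nonneg (g 1 1)]
  have h2 : g 1 1 = 0 := by nlinarith [sq_nonneg (g 1 0), sq_nonneg (g 1 1)]
  rw [h1, h2] at hg; simp at hg

lemma kk_im_moebius (g : M2) (hg : g.det = 1) :
    (moebius g Complex.I).im = 1 / (g 1 0 ^ 2 + g 1 1 ^ 2) := by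
  have h := kk_den_pos g hg
  rw [Matrix.det_fin_two] at hg
  unfold moebius
  rw [Complex.div_im]
  simp [Complex.normSq_apply]
  rw [← sub_div, inv_eq_one_div]
  congr 1 <;> nlinarith

lemma kk_moebius_mul (σ g : M2) (hg : g.det = 1) :
    moebius σ (moebius g Complex.I) = moebius (σ * g) Complex.I := by
  have h := kk_den_pos g hg
  unfold moebius
  have hd : (g 1 0 : ℂ) * Complex.I + (g 1 1 : ℂ) ≠ 0 := by
    intro h0
    have e1 := congrArg Complex.im h0
    have e2 := congrArg Complex.re h0
    simp at e1 e2
    rw [e1, e2] at h; simp at h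
  rw [← mul_div_mul_right _ _ hd]
  congr 1
  · simp only [Matrix.mul_apply, Fin.sum_univ_two]
    push_cast
    rw [add_mul, mul_assoc, div_mul_cancel₀ _ hd]; ring
  · simp only [Matrix.mul_apply, Fin.sum_univ_two]
    push_cast
    rw [add_mul, mul_assoc, div_mul_cancel₀ _ hd]; ring

lemma kk_im (σ g : M2) (hσ : σ.det = 1) (hg : g.det = 1) :
    (moebius σ (moebius g Complex.I)).im = 1 / ((σ * g) 1 0 ^ 2 + (σ * g) 1 1 ^ 2) := by
  rw [kk_moebius_mul σ g hg, kk_im_moebius]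
  rw [Matrix.det_mul, hσ, hg, one_mul]

lemma kk_AL_one (N : ℕ) : (1 : M2) ∈ AtkinLehner N := by
  refine ⟨by simp, 1, 1, 0, 0, 1, by norm_num, one_dvd _, ?_⟩
  ext i j; fin_cases i <;> fin_cases j <;> simp

lemma kk_AL_mul (N : ℕ) (hN : 0 < N) (σ τ : M2) (hσ : σ ∈ AtkinLehner N) (hτ : τ ∈ AtkinLehner N) :
    σ * τ ∈ AtkinLehner N := by
  obtain ⟨h1, Q, a, b, c, d, hQ, hQN, rfl⟩ := hσ
  obtain ⟨h2, Q', a', b', c', d', hQ', hQN', rfl⟩ := hτ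
  refine ⟨by rw [Matrix.det_mul, h1, h2, one_mul], ?_⟩
  clear h1 h2
  obtain ⟨k, q, q', hk, hcop, rfl, rfl⟩ := Nat.exists_coprime' (Nat.gcd_pos_of_pos_left Q' hQ)
  obtain ⟨m, rfl⟩ : k * (q * q') ∣ N := by
    have := Nat.lcm_dvd hQN hQN'
    rwa [Nat.lcm_mul_right, hcop.lcm_eq_mul, mul_comm] at this
  have hq : 0 < q := Nat.pos_of_ne_zero (by rintro rfl; simp at hQ)
  have hq' : 0 < q' := Nat.pos_of_ne_zero (by rintro rfl; simp at hQ')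
  refine ⟨q * q', k * a * a' + m * b * c', q * a * b' + q' * b * d', q' * c * a' + q * d * c', m * c * b' + k * d * d',
    by positivity, ?_, ?_⟩
  · exact ⟨k * m, by ring⟩
  have hkr : (0:ℝ) < k := by exact_mod_cast hk
  have hqr : (0:ℝ) < q := by exact_mod_cast hq
  have hqr' : (0:ℝ) < q' := by exact_mod_cast hq'
  have e : (√((q * k : ℕ):ℝ))⁻¹ * (√((q' * k : ℕ):ℝ))⁻¹ * k = (√((q * q' : ℕ):ℝ))⁻¹ := by
    push_cast
    rw [Real.sqrt_mul hqr.le, Real.sqrt_mul hqr'.le, Real.sqrt_mul hqr.le]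
    have := Real.mul_self_sqrt hkr.le
    have : √(k:ℝ) ≠ 0 := (Real.sqrt_pos.mpr hkr).ne'
    have : √(q:ℝ) ≠ 0 := (Real.sqrt_pos.mpr hqr).ne'
    have : √(q':ℝ) ≠ 0 := (Real.sqrt_pos.mpr hqr').ne'
    field_simp
    nlinarith
  rw [Matrix.smul_mul, Matrix.mul_smul, ← e, smul_smul, mul_smul _ (k:ℝ)]
  refine congrArg (fun X : M2 => ((√((q * k : ℕ):ℝ))⁻¹ * (√((q' * k : ℕ):ℝ))⁻¹) • X) ?_
  ext i j; fin_cases i <;> fin_cases j <;> simp [Matrix.mul_apply, Fin.sum_univ_two] <;> ring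

lemma kk_AL_bdd (N : ℕ) (hN : 0 < N) (g : M2) (hg : g.det = 1) :
    BddAbove ((fun σ => (moebius σ (moebius g Complex.I)).im) '' AtkinLehner N) := by
  have hD := kk_den_pos g hg
  set D := g 1 0 ^ 2 + g 1 1 ^ 2 with hDdef
  refine ⟨max D (1 / D * N), ?_⟩
  rintro _ ⟨σ, ⟨hdet, Q, a, b, c, d, hQ, hQN, hσ⟩, rfl⟩
  have hQr : (1:ℝ) ≤ Q := by exact_mod_cast hQ
  have hQNr : (Q:ℝ) ≤ N := by exact_mod_cast Nat.le_of_dvd hN hQN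
  have hsq : √(Q:ℝ) ^ 2 = Q := Real.sq_sqrt (by positivity)
  have hsp : 0 < √(Q:ℝ) := Real.sqrt_pos.mpr (by linarith)
  dsimp only
  rw [kk_im σ g hdet hg]
  have hpos := kk_den_pos (σ * g) (by rw [Matrix.det_mul, hdet, hg, one_mul])
  have e0 : σ 1 0 = (√(Q:ℝ))⁻¹ * (N * c) := by rw [hσ]; simp
  have e1 : σ 1 1 = (√(Q:ℝ))⁻¹ * (Q * d) := by rw [hσ]; simp
  rw [Matrix.det_fin_two] at hg
  have key : ((σ * g) 1 0 ^ 2 + (σ * g) 1 1 ^ 2) * D = (σ 1 0) ^ 2 + (σ 1 0 * (g 0 0 * g 1 0 + g 0 1 * g 1 1) + σ 1 1 * D) ^ 2 := by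
    simp only [Matrix.mul_apply, Fin.sum_univ_two, hDdef]
    linear_combination (σ 1 0)^2 * (g 0 0 * g 1 1 - g 0 1 * g 1 0 + 1) * hg
  by_cases hc : c = 0
  · have hs0 : σ 1 0 = 0 := by rw [e0, hc]; simp
    have hd : d ≠ 0 := by
      rintro rfl
      rw [Matrix.det_fin_two, hs0, e1] at hdet; simp at hdet
    have hd2 : (1:ℝ) ≤ (d:ℝ) ^ 2 := by
      have : 1 ≤ d ^ 2 := by have := sq_nonneg d; have : d^2 ≠ 0 := pow_ne_zero 2 hd; omega
      exact_mod_cast this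
    have h11 : 1 ≤ (σ 1 1) ^ 2 := by
      rw [e1, mul_pow, inv_pow, hsq]
      field_simp
      nlinarith
    rw [hs0] at key
    have hDe : D ≤ (σ * g) 1 0 ^ 2 + (σ * g) 1 1 ^ 2 := by
      have : ((σ * g) 1 0 ^ 2 + (σ * g) 1 1 ^ 2) = (σ 1 1)^2 * D := by
        apply mul_right_cancel₀ hD.ne'; rw [key]; ring
      rw [this]; nlinarith
    refine le_trans ?_ (le_max_right _ _)
    calc _ ≤ 1 / D := one_div_le_one_div_of_le hD hDe
      _ ≤ _ := by
        have : 0 < 1 / D := by positivity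
        nlinarith
  · have hc2 : (1:ℝ) ≤ (c:ℝ) ^ 2 := by
      have : 1 ≤ c ^ 2 := by have := sq_nonneg c; have : c^2 ≠ 0 := pow_ne_zero 2 hc; omega
      exact_mod_cast this
    have h10 : 1 ≤ (σ 1 0) ^ 2 := by
      rw [e0, mul_pow, inv_pow, hsq]
      rw [inv_mul_eq_div, one_le_div (by linarith)]
      have h1 : (1:ℝ) ≤ N := hQr.trans hQNr
      calc (Q:ℝ) ≤ N * 1 := by linarith
        _ ≤ N * (N * c ^ 2) := by gcongr; nlinarith
        _ = _ := by ring
    refine le_trans ?_ (le_max_left _ _)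
    rw [div_le_iff₀ hpos, mul_comm, key]
    nlinarith [sq_nonneg (σ 1 0 * (g 0 0 * g 1 0 + g 0 1 * g 1 1) + σ 1 1 * D)]

/-- Reduction: a near-maximal translate. -/
lemma kk_reduce (N : ℕ) (hN : 0 < N) (g : M2) (hg : g.det = 1) :
    ∃ τ ∈ AtkinLehner N, 1 / ((τ * g) 1 0 ^ 2 + (τ * g) 1 1 ^ 2) ≤ Hgt N g ∧
      ∀ σ ∈ AtkinLehner N, 1 / ((σ * (τ * g)) 1 0 ^ 2 + (σ * (τ * g)) 1 1 ^ 2) ≤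
        2 * (1 / ((τ * g) 1 0 ^ 2 + (τ * g) 1 1 ^ 2)) := by
  have hb := kk_AL_bdd N hN g hg
  have hle : ∀ σ ∈ AtkinLehner N, 1 / ((σ * g) 1 0 ^ 2 + (σ * g) 1 1 ^ 2) ≤ Hgt N g := by
    intro σ hσ
    rw [← kk_im σ g hσ.1 hg]
    exact le_csSup hb ⟨σ, hσ, rfl⟩
  have hH : 0 < Hgt N g := by
    refine lt_of_lt_of_le ?_ (hle 1 (kk_AL_one N))
    have := kk_den_pos g hg
    rw [one_mul]; positivity
  obtain ⟨_, ⟨τ, hτ, rfl⟩, hlt⟩ := exists_lt_of_lt_csSup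
    (s := (fun σ => (moebius σ (moebius g Complex.I)).im) '' AtkinLehner N)
    ⟨_, 1, kk_AL_one N, rfl⟩ (show Hgt N g / 2 < Hgt N g by linarith)
  refine ⟨τ, hτ, hle τ hτ, fun σ hσ => ?_⟩
  have h1 := hle (σ * τ) (kk_AL_mul N hN σ τ hσ hτ)
  dsimp only at hlt
  rw [kk_im τ g hτ.1 hg] at hlt
  rw [Matrix.mul_assoc] at h1
  linarith

lemma kk_conj (N ℓ : ℕ) (hN : 0 < N) (hℓ : 0 < ℓ) (hℓN : ℓ ∣ N) (τ γ : M2) (hτ : τ ∈ AtkinLehner N)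
    (hγ : γ ∈ Rlat N ℓ) : τ * γ * τ⁻¹ ∈ Rlat N ℓ := by
  obtain ⟨hdet, Q, a, b, c, d, hQ, ⟨M, hM⟩, hτe⟩ := hτ
  obtain ⟨q, hq⟩ := hℓN
  obtain ⟨⟨α, hα⟩, ⟨β, hβ⟩, ⟨κ, hκ⟩, ⟨η, hη⟩⟩ := hγ
  have hℓr : (0:ℝ) < ℓ := by exact_mod_cast hℓ
  have hQr : (0:ℝ) < Q := by exact_mod_cast hQ
  have hNM : (N:ℝ) = Q * M := by exact_mod_cast hM
  have hNq : (N:ℝ) = ℓ * q := by exact_mod_cast hq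
  have hNr : (0:ℝ) < N := by exact_mod_cast hN
  have hs : (√(Q:ℝ))⁻¹ * (√(Q:ℝ))⁻¹ = 1 / Q := by
    rw [← mul_inv, Real.mul_self_sqrt hQr.le, one_div]
  have hinv : τ⁻¹ = !![τ 1 1, - τ 0 1; - τ 1 0, τ 0 0] := by
    rw [Matrix.inv_def, hdet, Matrix.adjugate_fin_two]; simp
  have t00 : τ 0 0 = (√(Q:ℝ))⁻¹ * (Q * a) := by rw [hτe]; simp
  have t01 : τ 0 1 = (√(Q:ℝ))⁻¹ * b := by rw [hτe]; simp
  have t10 : τ 1 0 = (√(Q:ℝ))⁻¹ * (N * c) := by rw [hτe]; simp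
  have t11 : τ 1 1 = (√(Q:ℝ))⁻¹ * (Q * d) := by rw [hτe]; simp
  have hqM : (q:ℝ) * ℓ = Q * M := by rw [← hNM, hNq]; ring
  refine ⟨⟨Q * a * d * α + b * d * q * κ - a * c * β * q - M * b * c * η, ?_⟩,
    ⟨- ℓ * a * b * α - b^2 * κ * M + Q * a^2 * β + ℓ * a * b * η, ?_⟩,
    ⟨ℓ * c * d * α + Q * d^2 * κ - M * c^2 * β - ℓ * c * d * η, ?_⟩,
    ⟨-M * b * c * α - b * d * q * κ + a * c * β * q + Q * a * d * η, ?_⟩⟩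
  all_goals
    rw [hinv]
    simp only [Matrix.mul_apply, Fin.sum_univ_two, Matrix.cons_val', Matrix.cons_val_zero, Matrix.cons_val_one,
      Matrix.of_apply, Matrix.cons_val_fin_one, hα, hβ, hκ, hη, t00, t01, t10, t11]
    push_cast
  · have : (N:ℝ) / ℓ = q := by rw [hNq]; field_simp
    calc _ = ((√(Q:ℝ))⁻¹ * (√(Q:ℝ))⁻¹) * (Q * d * (Q * a * α + b * (κ * (N / ℓ))) - c * (Q * a * β * (N / ℓ) + N * b * η)) := by
          field_simp; ring
      _ = _ := by rw [hs, this, hNM]; field_simp; ring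
  · calc _ = ((√(Q:ℝ))⁻¹ * (√(Q:ℝ))⁻¹) * (-b * (Q * a * α + b * (κ * N / ℓ)) + Q * a * (Q * a * β / ℓ + b * η)) := by
          field_simp
      _ = _ := by rw [hs, hNM]; field_simp; ring
  · calc _ = ((√(Q:ℝ))⁻¹ * (√(Q:ℝ))⁻¹) * (Q * d * (N * c * α + Q * d * (κ * N / ℓ)) - N * c * (N * c * β / ℓ + Q * d * η)) := by
          field_simp; ring
      _ = _ := by rw [hs, hNM]; field_simp; ring
  · have : (N:ℝ) / ℓ = q := by rw [hNq]; field_simp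
    calc _ = ((√(Q:ℝ))⁻¹ * (√(Q:ℝ))⁻¹) * (-b * (N * c * α + Q * d * (κ * (N / ℓ))) + Q * a * (c * β * (N / ℓ) + Q * d * η)) := by
          field_simp
      _ = _ := by rw [hs, this, hNM]; field_simp; ring

/-- Minimum of the lattice at a reduced point. -/
lemma kk_min (N : ℕ) (hN : 0 < N) (hsf : Squarefree N) (h : M2) (hh : h.det = 1)
    (hred : ∀ σ ∈ AtkinLehner N, 1 / ((σ * h) 1 0 ^ 2 + (σ * h) 1 1 ^ 2) ≤
        2 * (1 / (h 1 0 ^ 2 + h 1 1 ^ 2))) (x y : ℝ) (hy : y = 1 / (h 1 0 ^ 2 + h 1 1 ^ 2))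
    (hx : x = (h 0 0 * h 1 0 + h 0 1 * h 1 1) * y) (C A : ℤ) (hCA : C ≠ 0 ∨ A ≠ 0) :
    ∃ k r Q : ℕ, 0 < k ∧ 0 < Q ∧ 0 < r ∧ Q * r = N ∧ (∀ q : ℕ, q ∣ N → (q : ℤ) ∣ C → q ≤ k * r) ∧
      (k:ℝ) ^ 2 / (2 * Q) ≤ (C * x + A) ^ 2 + (C * y) ^ 2 := by
  have hkpos : 0 < Int.gcd C A := by
    rw [Int.gcd_pos_iff]; tauto
  obtain ⟨C1, A1, hcop, hC, hA⟩ := Int.exists_gcd_one hkpos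
  set k := Int.gcd C A with hk
  set r := Int.gcd C1 N with hr
  have hrN : r ∣ N := by have := Int.gcd_dvd_right C1 (N:ℤ); exact_mod_cast this
  have hrpos : 0 < r := Nat.pos_of_dvd_of_pos hrN hN
  obtain ⟨Q, hQ⟩ := hrN
  have hQpos : 0 < Q := Nat.pos_of_ne_zero (by rintro rfl; omega)
  obtain ⟨c, hc⟩ : (r:ℤ) ∣ C1 := Int.gcd_dvd_left C1 (N:ℤ)
  have hD := kk_den_pos h hh
  have hypos : 0 < y := by rw [hy]; positivity
  refine ⟨k, r, Q, hkpos, hQpos, hrpos, by rw [hQ]; ring, ?_, ?_⟩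
  · intro q hqN hqC
    have h1 : (q:ℤ) ∣ k * r := by
      have : (q : ℤ) ∣ Int.gcd (k * C1) (k * N) := by
        apply Int.dvd_coe_gcd
        · rw [mul_comm, ← hC]; exact hqC
        · exact Dvd.dvd.mul_left (by exact_mod_cast hqN) _
      rw [Int.gcd_mul_left] at this
      simpa using this
    exact Nat.le_of_dvd (by positivity) (by exact_mod_cast h1)
  · have hcopQ : IsCoprime (Q * A1 : ℤ) C1 := by
      rw [IsCoprime.mul_left_iff]
      refine ⟨?_, ?_⟩
      · rw [Int.isCoprime_iff_gcd_eq_one]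
        by_contra hne
        obtain ⟨p, hp, hpd⟩ := Nat.exists_prime_and_dvd hne
        have h1 : (p:ℤ) ∣ Q := (Int.natCast_dvd_natCast.mpr hpd).trans (Int.gcd_dvd_left ..)
        have h2 : (p:ℤ) ∣ C1 := (Int.natCast_dvd_natCast.mpr hpd).trans (Int.gcd_dvd_right ..)
        have h3 : (p:ℤ) ∣ N := h1.trans (by rw [hQ]; push_cast; exact Dvd.intro_left _ rfl)
        have h4 : (p:ℤ) ∣ r := Int.dvd_coe_gcd h2 h3
        have h1' : p ∣ Q := by exact_mod_cast h1
        have h4' : p ∣ r := by exact_mod_cast h4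
        have h5 : p * p ∣ N := by rw [hQ]; exact mul_dvd_mul h4' h1'
        have := hsf p h5
        exact hp.one_lt.ne' (Nat.isUnit_iff.mp this)
      · rw [isCoprime_comm, Int.isCoprime_iff_gcd_eq_one]; exact hcop
    obtain ⟨u, v, huv⟩ := hcopQ
    have hQr : (0:ℝ) < Q := by exact_mod_cast hQpos
    have hs : (√(Q:ℝ))⁻¹ * (√(Q:ℝ))⁻¹ = 1 / Q := by
      rw [← mul_inv, Real.mul_self_sqrt hQr.le, one_div]
    have hNr : (N:ℝ) = r * Q := by exact_mod_cast hQ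
    have hcr : (C1:ℝ) = r * c := by exact_mod_cast hc
    have huvr : (u:ℝ) * (Q * A1) + v * C1 = 1 := by exact_mod_cast huv
    set σ : M2 := (√(Q:ℝ))⁻¹ • !![(Q : ℝ) * u, ((-v:ℤ) : ℝ); (N : ℝ) * c, (Q : ℝ) * A1] with hσ
    have hσm : σ ∈ AtkinLehner N := by
      refine ⟨?_, Q, u, -v, c, A1, hQpos, ⟨r, by rw [hQ]; ring⟩, rfl⟩
      rw [hσ, Matrix.det_fin_two]
      simp
      calc _ = ((√(Q:ℝ))⁻¹ * (√(Q:ℝ))⁻¹) * (Q * (u * (Q * A1) + v * (r * c))) := by rw [hNr]; ring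
        _ = 1 := by rw [hs, ← hcr, huvr]; field_simp
    have h1 := hred σ hσm
    have hσh : (σ * h).det = 1 := by rw [Matrix.det_mul, hσm.1, hh, one_mul]
    have hpos := kk_den_pos (σ * h) hσh
    have e10 : σ 1 0 = (√(Q:ℝ))⁻¹ * (Q * C1) := by rw [hσ, hcr, hNr]; simp; left; ring
    have e11 : σ 1 1 = (√(Q:ℝ))⁻¹ * (Q * A1) := by rw [hσ]; simp
    rw [Matrix.det_fin_two] at hh
    have key : ((σ * h) 1 0 ^ 2 + (σ * h) 1 1 ^ 2) * y = Q * ((C1 * x + A1)^2 + (C1 * y)^2) := by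
      have e0 : ((σ * h) 1 0 ^ 2 + (σ * h) 1 1 ^ 2) = ((√(Q:ℝ))⁻¹ * (√(Q:ℝ))⁻¹) * Q^2 * ((C1 * h 0 0 + A1 * h 1 0)^2 + (C1 * h 0 1 + A1 * h 1 1)^2) := by
        simp only [Matrix.mul_apply, Fin.sum_univ_two, e10, e11]; ring
      rw [e0, hs, hx, hy]
      field_simp
      linear_combination (C1:ℝ)^2 * (h 0 0 * h 1 1 - h 0 1 * h 1 0 + 1) * hh
    rw [← hy, div_le_iff₀ hpos] at h1
    have h2 : 1 / (2 * (Q:ℝ)) ≤ (C1 * x + A1)^2 + (C1 * y)^2 := by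
      rw [div_le_iff₀ (by positivity)]
      nlinarith
    have h3 : ((C:ℝ) * x + A) ^ 2 + (C * y) ^ 2 = k^2 * ((C1 * x + A1)^2 + (C1 * y)^2) := by
      have hC' : (C:ℝ) = C1 * k := by exact_mod_cast hC
      have hA' : (A:ℝ) = A1 * k := by exact_mod_cast hA
      rw [hC', hA']; ring
    rw [h3]
    calc (k:ℝ)^2 / (2 * Q) = k^2 * (1 / (2 * (Q:ℝ))) := by ring
      _ ≤ _ := by gcongr

lemma kk_card_fiber {α β : Type*} [DecidableEq β] (s : Finset α) (t : Finset β) (f : α → β)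
    (hf : ∀ a ∈ s, f a ∈ t) (B : ℝ) (hB : ∀ b ∈ t, ((s.filter (fun a => f a = b)).card : ℝ) ≤ B) :
    (s.card : ℝ) ≤ B * t.card := by
  rw [Finset.card_eq_sum_card_fiberwise hf]
  push_cast
  calc _ ≤ ∑ b ∈ t, B := Finset.sum_le_sum hB
    _ = _ := by rw [Finset.sum_const, nsmul_eq_mul, mul_comm]

lemma kk_card_Icc (a len : ℝ) (hlen : 0 ≤ len) : ((Finset.Icc ⌈a⌉ ⌊a + len⌋).card : ℝ) ≤ len + 1 := by
  rw [Int.card_Icc]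
  have h1 := Int.floor_le (a + len)
  have h2 := Int.le_ceil a
  have h3 : ((⌊a + len⌋ + 1 - ⌈a⌉ : ℤ) : ℝ) ≤ len + 1 := by push_cast; linarith
  rcases le_total 0 (⌊a + len⌋ + 1 - ⌈a⌉) with h | h
  · have : (((⌊a + len⌋ + 1 - ⌈a⌉).toNat : ℤ) : ℝ) = ((⌊a + len⌋ + 1 - ⌈a⌉ : ℤ) : ℝ) := by
      rw [Int.toNat_of_nonneg h]
    have h4 : (((⌊a + len⌋ + 1 - ⌈a⌉).toNat : ℕ) : ℝ) = ((⌊a + len⌋ + 1 - ⌈a⌉ : ℤ) : ℝ) := by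
      exact_mod_cast this
    rw [h4]; exact h3
  · rw [Int.toNat_of_nonpos h]; push_cast; linarith

lemma kk_fib {α : Type*} (T : Finset α) (f : α → ℤ) (hinj : Set.InjOn f T) (a len : ℝ) (hlen : 0 ≤ len)
    (hb : ∀ t ∈ T, a ≤ f t ∧ (f t : ℝ) ≤ a + len) : (T.card : ℝ) ≤ len + 1 := by
  refine le_trans ?_ (kk_card_Icc a len hlen)
  have : T.card ≤ (Finset.Icc ⌈a⌉ ⌊a + len⌋).card := by
    refine Finset.card_le_card_of_injOn f (fun t ht => ?_) hinj
    have := hb t ht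
    rw [Finset.coe_Icc]
    exact ⟨Int.ceil_le.mpr this.1, Int.le_floor.mpr this.2⟩
  exact_mod_cast this

lemma kk_card_Icc2 (a len : ℝ) (hlen : 0 ≤ len) : ((Finset.Icc ⌊a⌋ ⌊a + len⌋).card : ℝ) ≤ len + 2 := by
  rw [Int.card_Icc]
  have h1 := Int.floor_le (a + len)
  have h2 := Int.lt_floor_add_one a
  have h : 0 ≤ (⌊a + len⌋ + 1 - ⌊a⌋) := by
    have := Int.floor_le_floor (show a ≤ a + len by linarith); omega
  have h3 : ((⌊a + len⌋ + 1 - ⌊a⌋ : ℤ) : ℝ) ≤ len + 2 := by push_cast; linarith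
  have h4 : (((⌊a + len⌋ + 1 - ⌊a⌋).toNat : ℕ) : ℝ) = ((⌊a + len⌋ + 1 - ⌊a⌋ : ℤ) : ℝ) := by
    exact_mod_cast Int.toNat_of_nonneg h
  rw [h4]; exact h3

/-- Pigeonhole for separated points in a square. -/
lemma kk_box {α : Type*} (T : Finset α) (f1 f2 : α → ℝ) (h len a b : ℝ) (hh : 0 < h) (hlen : 0 ≤ len)
    (h1 : ∀ t ∈ T, a ≤ f1 t ∧ f1 t ≤ a + len) (h2 : ∀ t ∈ T, b ≤ f2 t ∧ f2 t ≤ b + len)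
    (hsep : ∀ s ∈ T, ∀ t ∈ T, s ≠ t → 2 * h ^ 2 ≤ (f1 s - f1 t) ^ 2 + (f2 s - f2 t) ^ 2) :
    (T.card : ℝ) ≤ (len / h + 2) ^ 2 := by
  have hm : T.card ≤ (Finset.Icc ⌊a / h⌋ ⌊a / h + len / h⌋ ×ˢ Finset.Icc ⌊b / h⌋ ⌊b / h + len / h⌋).card := by
    refine Finset.card_le_card_of_injOn (fun t => (⌊f1 t / h⌋, ⌊f2 t / h⌋)) (fun t ht => ?_) ?_
    · have e1 := h1 t ht
      have e2 := h2 t ht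
      simp only [Finset.coe_product, Finset.coe_Icc, Set.mem_prod, Set.mem_Icc]
      refine ⟨⟨Int.floor_le_floor ?_, Int.floor_le_floor ?_⟩, Int.floor_le_floor ?_, Int.floor_le_floor ?_⟩
      · gcongr; exact e1.1
      · rw [← add_div]; gcongr; exact e1.2
      · gcongr; exact e2.1
      · rw [← add_div]; gcongr; exact e2.2
    · intro s hs t ht hst
      by_contra hne
      have := hsep s hs t ht hne
      simp only [Prod.mk.injEq] at hst
      have a1 := Int.abs_sub_lt_one_of_floor_eq_floor hst.1
      have a2 := Int.abs_sub_lt_one_of_floor_eq_floor hst.2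
      rw [← sub_div, abs_div, abs_of_pos hh, div_lt_one hh] at a1 a2
      have b1 := sq_lt_sq' (by linarith [abs_nonneg (f1 s - f1 t)]) a1
      have b2 := sq_lt_sq' (by linarith [abs_nonneg (f2 s - f2 t)]) a2
      rw [sq_abs] at b1 b2
      linarith
  calc (T.card : ℝ) ≤ ((Finset.Icc ⌊a / h⌋ ⌊a / h + len / h⌋ ×ˢ Finset.Icc ⌊b / h⌋ ⌊b / h + len / h⌋).card : ℝ) := by
        exact_mod_cast hm
    _ ≤ (len / h + 2) * (len / h + 2) := by
      rw [Finset.card_product]; push_cast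
      have := kk_card_Icc2 (a / h) (len / h) (by positivity)
      have := kk_card_Icc2 (b / h) (len / h) (by positivity)
      gcongr
    _ = _ := by ring

/-- Integers in one square class. -/
lemma kk_sqclass (Z : Finset ℤ) (K : ℝ) (hK : 0 ≤ K) (hZ : ∀ n ∈ Z, |(n : ℝ)| ≤ K ^ 2)
    (hsq : ∀ n ∈ Z, ∀ n' ∈ Z, ∃ B : ℤ, n * n' = B ^ 2) : (Z.card : ℝ) ≤ K + 1 := by
  have hdec : ∀ n : ℤ, ∃ b a : ℕ, n.natAbs = b ^ 2 * a ∧ (Squarefree a) := by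
    intro n
    obtain ⟨a, b, h1, h2⟩ := Nat.sq_mul_squarefree n.natAbs
    exact ⟨b, a, h1.symm, h2⟩
  choose b a hba hsf using hdec
  have hb0 : ∀ n, n ≠ 0 → b n ≠ 0 := by
    intro n hn h0
    have := hba n
    rw [h0] at this; simp at this; exact hn this
  have haeq : ∀ n ∈ Z, ∀ n' ∈ Z, n ≠ 0 → n' ≠ 0 → a n = a n' := by
    intro n hn n' hn' h0 h0'
    obtain ⟨B, hB⟩ := hsq n hn n' hn'
    have h1 : (b n * b n') ^ 2 * (a n * a n') = B.natAbs ^ 2 := by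
      rw [← Int.natAbs_pow, ← hB, Int.natAbs_mul, hba n, hba n']; ring
    have h2 : b n * b n' ∣ B.natAbs := by
      rw [← Nat.pow_dvd_pow_iff (n := 2) (by norm_num)]; exact Dvd.intro _ h1
    obtain ⟨j, hj⟩ := h2
    have h3 : a n * a n' = j ^ 2 := by
      rw [hj, mul_pow _ j] at h1
      exact Nat.eq_of_mul_eq_mul_left (pow_pos (Nat.mul_pos (Nat.pos_of_ne_zero (hb0 n h0)) (Nat.pos_of_ne_zero (hb0 n' h0'))) 2) h1
    have aux : ∀ u v : ℕ, Squarefree u → Squarefree v → u * v = j ^ 2 → v ∣ u := by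
      intro u v hu hv huv
      have d1 : u ∣ j := (hu.dvd_pow_iff_dvd (by norm_num)).mp (Dvd.intro _ huv)
      obtain ⟨i, rfl⟩ := d1
      have hu0 : 0 < u := Nat.pos_of_ne_zero hu.ne_zero
      have e1 : v = u * (i * i) := by
        apply Nat.eq_of_mul_eq_mul_left hu0; rw [huv]; ring
      have e2 := hv i (by rw [e1]; exact Dvd.intro_left _ rfl)
      rw [Nat.isUnit_iff] at e2
      rw [e1, e2]; simp
    exact Nat.dvd_antisymm (aux _ _ (hsf n') (hsf n) (by rw [mul_comm]; exact h3)) (aux _ _ (hsf n) (hsf n') h3)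
  have hz : b 0 ^ 2 * a 0 = 0 := by rw [← hba 0]; rfl
  have hb00 : b 0 = 0 := by
    rcases Nat.mul_eq_zero.mp hz with h | h
    · simpa using h
    · exact absurd h (hsf 0).ne_zero
  have hcard : Z.card ≤ (Finset.range (⌊K⌋₊ + 1)).card := by
    refine Finset.card_le_card_of_injOn b (fun n hn => ?_) ?_
    · simp only [Finset.coe_range, Set.mem_Iio, Order.lt_add_one_iff]
      refine Nat.le_floor ?_
      have h1 := hZ n hn
      have h2 : (b n : ℝ) ^ 2 ≤ |(n:ℝ)| := by
        have : b n ^ 2 ≤ n.natAbs := by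
          rw [hba n]; exact Nat.le_mul_of_pos_right _ (Nat.pos_of_ne_zero (hsf n).ne_zero)
        have h3 : ((b n ^ 2 : ℕ) : ℝ) ≤ (n.natAbs : ℝ) := by exact_mod_cast this
        rw [Nat.cast_natAbs] at h3
        push_cast at h3; exact h3
      exact abs_le_of_sq_le_sq (h2.trans h1) hK |>.trans' (le_abs_self _)
    · intro n hn n' hn' hbb
      by_cases h0 : n = 0
      · by_contra hne
        have : n' ≠ 0 := fun h => hne (by rw [h0, h])
        apply hb0 n' this
        rw [← hbb, h0, hb00]
      · have h0' : n' ≠ 0 := by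
          intro h; apply hb0 n h0; rw [hbb, h, hb00]
        have e1 : n.natAbs = n'.natAbs := by
          rw [hba n, hba n', hbb, haeq n hn n' hn' h0 h0']
        rcases Int.natAbs_eq_natAbs_iff.mp e1 with h | h
        · exact h
        · obtain ⟨B, hB⟩ := hsq n hn n' hn'
          rw [h] at hB
          have : 0 < n' ^ 2 := by positivity
          nlinarith [sq_nonneg B]
  rw [Finset.card_range] at hcard
  calc (Z.card : ℝ) ≤ ((⌊K⌋₊ + 1 : ℕ) : ℝ) := by exact_mod_cast hcard
    _ ≤ _ := by push_cast; linarith [Nat.floor_le hK]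

def kkdet3 (v w u : ℤ × ℤ × ℤ) : ℤ :=
  v.1 * (w.2.1 * u.2.2 - w.2.2 * u.2.1) - v.2.1 * (w.1 * u.2.2 - w.2.2 * u.1)
    + v.2.2 * (w.1 * u.2.1 - w.2.1 * u.1)

lemma kk_count3 (v w u : ℤ × ℤ × ℤ) (hd : kkdet3 v w u ≠ 0) (S : Finset (ℤ × ℤ × ℤ))
    (h1 : ∀ s ∈ S, |kkdet3 s w u| ≤ |kkdet3 v w u|) (h2 : ∀ s ∈ S, |kkdet3 v s u| ≤ |kkdet3 v w u|)
    (h3 : ∀ s ∈ S, |kkdet3 v w s| ≤ |kkdet3 v w u|) :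
    (S.card : ℝ) ≤ 125 * |(kkdet3 v w u : ℝ)| := by
  classical
  let A : Matrix (Fin 3) (Fin 3) ℤ := !![v.1, w.1, u.1; v.2.1, w.2.1, u.2.1; v.2.2, w.2.2, u.2.2]
  have hA : A.det = kkdet3 v w u := by
    simp [A, Matrix.det_fin_three, kkdet3]; ring
  let F : ℤ × ℤ × ℤ → (Fin 3 → ℤ) := fun s => ![s.1, s.2.1, s.2.2]
  have hF : Function.Injective F := by
    rintro ⟨a, b, c⟩ ⟨a', b', c'⟩ h
    have e0 := congrFun h 0; have e1 := congrFun h 1; have e2 := congrFun h 2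
    simp [F] at e0 e1 e2
    simp [e0, e1, e2]
  have := kk_index A (by rw [hA]; exact hd) (S.image F) ?_
  · rw [Finset.card_image_of_injective _ hF, hA] at this
    have h' : ((S.card : ℕ) : ℝ) ≤ ((125 * (kkdet3 v w u).natAbs : ℕ) : ℝ) := by exact_mod_cast this
    push_cast at h'
    rw [Nat.cast_natAbs] at h'
    push_cast at h'
    exact h'
  · intro s hs
    obtain ⟨s, hs', rfl⟩ := Finset.mem_image.mp hs
    have hdr : (kkdet3 v w u : ℝ) ≠ 0 := by exact_mod_cast hd
    have hdp : 0 < |(kkdet3 v w u : ℝ)| := abs_pos.mpr hdr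
    refine ⟨![kkdet3 s w u / kkdet3 v w u, kkdet3 v s u / kkdet3 v w u, kkdet3 v w s / kkdet3 v w u], ?_, ?_⟩
    · have g1 := h1 s hs'
      have g2 := h2 s hs'
      have g3 := h3 s hs'
      intro i
      fin_cases i
      · simp only [Fin.zero_eta, Matrix.cons_val_zero]
        rw [abs_div, div_le_one hdp]; exact_mod_cast g1
      · simp only [Fin.mk_one, Matrix.cons_val_one, Matrix.cons_val_zero]
        rw [abs_div, div_le_one hdp]; exact_mod_cast g2
      · simp only [Fin.reduceFinMk, Matrix.cons_val]
        rw [abs_div, div_le_one hdp]; exact_mod_cast g3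
    · have e : ∀ X : ℝ, ∀ a b c d1 d2 d3 d: ℝ, d ≠ 0 → d * X = a * d1 + b * d2 + c * d3 →
          X = a * (d1 / d) + b * (d2 / d) + c * (d3 / d) := by
        intro X a b c d1 d2 d3 d hd h
        field_simp; linarith
      intro i
      fin_cases i
      all_goals
        simp only [Fin.sum_univ_three, A, F]
        simp
        refine e _ _ _ _ _ _ _ _ hdr ?_
        simp only [kkdet3]
        push_cast
        ring

structure KK where
  q : ℕ
  l : ℕ
  x : ℝ
  y : ℝ
  δ : ℝ
  L : ℝ
  hq : 0 < q
  hl : 0 < l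
  hsf : Squarefree q
  hcop : Nat.Coprime q l
  hy : 0 < y
  hδ : 0 < δ
  hδ1 : δ ≤ 1
  hL : 0 < L
  min1 : ∀ c d : ℤ, (c ≠ 0 ∨ d ≠ 0) → 1 / (2 * ((q : ℝ) * l)) ≤ (c * x + d) ^ 2 + (c * y) ^ 2
  min2 : ∀ c d : ℤ, (c ≠ 0 ∨ d ≠ 0) → 1 / (2 * (l : ℝ)) ≤ (q * c * x + d) ^ 2 + (q * c * y) ^ 2

namespace KK

noncomputable def V (K : KK) (s : ℤ × ℤ × ℤ) : ℝ := s.1 - 2 * K.x * K.q * s.2.2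
noncomputable def T (K : KK) (s : ℤ × ℤ × ℤ) : ℝ := (s.2.1 / K.l + s.1 * K.x - K.q * s.2.2 * K.x ^ 2) / K.y
noncomputable def W (K : KK) (s : ℤ × ℤ × ℤ) : ℝ := K.T s + K.y * K.q * s.2.2
noncomputable def U (K : KK) (s : ℤ × ℤ × ℤ) : ℝ := K.y * K.q * s.2.2 - K.T s
noncomputable def ρ (K : KK) : ℝ := √K.δ * K.L
noncomputable def X (K : KK) : ℝ := K.l * K.δ * K.L ^ 2 / K.q
def InS (K : KK) (s : ℤ × ℤ × ℤ) : Prop :=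
  (K.V s) ^ 2 + (K.W s) ^ 2 ≤ 4 * K.δ * K.L ^ 2 ∧ (K.U s) ^ 2 ≤ 4 * K.L ^ 2
def Dz (K : KK) (s : ℤ × ℤ × ℤ) : ℤ := K.l * s.1 ^ 2 + 4 * K.q * (s.2.1 * s.2.2)
def Bz (K : KK) (s t : ℤ × ℤ × ℤ) : ℤ := K.l * (s.1 * t.1) + 2 * K.q * (s.2.1 * t.2.2 + t.2.1 * s.2.2)
def Gz (K : KK) (s t : ℤ × ℤ × ℤ) : ℤ :=
  K.l * (s.1 * t.2.1 - t.1 * s.2.1) * (s.1 * t.2.2 - t.1 * s.2.2)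
    - K.q * (s.2.1 * t.2.2 - t.2.1 * s.2.2) ^ 2

lemma ρpos (K : KK) : 0 < K.ρ := mul_pos (Real.sqrt_pos.mpr K.hδ) K.hL
lemma ρsq (K : KK) : K.ρ ^ 2 = K.δ * K.L ^ 2 := by
  rw [ρ, mul_pow, Real.sq_sqrt K.hδ.le]
lemma ρL (K : KK) : K.ρ ≤ K.L := by
  have : √K.δ ≤ 1 := Real.sqrt_le_one.mpr K.hδ1
  have := K.hL
  rw [ρ]; nlinarith
lemma Xpos (K : KK) : 0 < K.X := by
  have := K.hq; have := K.hl; have := K.hδ; have := K.hL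
  unfold X; positivity
lemma lpos (K : KK) : (0:ℝ) < K.l := by exact_mod_cast K.hl
lemma qpos (K : KK) : (0:ℝ) < K.q := by exact_mod_cast K.hq
lemma qX (K : KK) : K.q * K.X = K.l * K.ρ ^ 2 := by
  have := K.qpos
  rw [ρsq, X]; field_simp

lemma Beq (K : KK) (s t : ℤ × ℤ × ℤ) :
    (K.Bz s t : ℝ) = K.l * (K.V s * K.V t + K.W s * K.W t - K.U s * K.U t) := by
  have := K.lpos; have := K.hy
  simp only [Bz, V, W, U, T]; push_cast; field_simp; ring

lemma Deq (K : KK) (s : ℤ × ℤ × ℤ) :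
    (K.Dz s : ℝ) = K.l * (K.V s ^ 2 + K.W s ^ 2 - K.U s ^ 2) := by
  have := K.Beq s s
  have h : K.Bz s s = K.Dz s := by simp only [Bz, Dz]; ring
  rw [← h, this]; ring

lemma DBG (K : KK) (s t : ℤ × ℤ × ℤ) : K.Dz s * K.Dz t - K.Bz s t ^ 2 = 4 * K.q * K.Gz s t := by
  simp only [Bz, Dz, Gz]; ring

lemma Geq (K : KK) (s t : ℤ × ℤ × ℤ) : 4 * (K.q : ℝ) * K.Gz s t = K.l ^ 2 *
    ((K.V s * K.W t - K.V t * K.W s) ^ 2 - (K.V s * K.U t - K.V t * K.U s) ^ 2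
      - (K.W s * K.U t - K.W t * K.U s) ^ 2) := by
  have h := K.DBG s t
  have h' : (K.Dz s : ℝ) * K.Dz t - K.Bz s t ^ 2 = 4 * K.q * K.Gz s t := by exact_mod_cast h
  rw [← h', Beq, Deq, Deq]; ring

lemma det3eq (K : KK) (s t u : ℤ × ℤ × ℤ) : K.V s * (K.W t * K.U u - K.U t * K.W u)
    - K.W s * (K.V t * K.U u - K.U t * K.V u) + K.U s * (K.V t * K.W u - K.W t * K.V u)
    = 2 * (K.q / K.l) * kkdet3 s t u := by
  have := K.lpos; have := K.hy
  simp only [V, W, U, T, kkdet3]; push_cast; field_simp; ring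

lemma absV (K : KK) {s : ℤ × ℤ × ℤ} (h : K.InS s) : |K.V s| ≤ 2 * K.ρ :=
  abs_le_of_sq_le_sq (by have := h.1; have := K.ρsq; nlinarith [sq_nonneg (K.W s)]) (by linarith [K.ρpos])
lemma absW (K : KK) {s : ℤ × ℤ × ℤ} (h : K.InS s) : |K.W s| ≤ 2 * K.ρ :=
  abs_le_of_sq_le_sq (by have := h.1; have := K.ρsq; nlinarith [sq_nonneg (K.V s)]) (by linarith [K.ρpos])
lemma absU (K : KK) {s : ℤ × ℤ × ℤ} (h : K.InS s) : |K.U s| ≤ 2 * K.L :=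
  abs_le_of_sq_le_sq (by have := h.2; nlinarith) (by linarith [K.hL])

lemma kk_wedge (a b c d A B : ℝ) (ha : |a| ≤ A) (hb : |b| ≤ A) (hc : |c| ≤ B) (hd : |d| ≤ B) :
    |a * c - b * d| ≤ 2 * (A * B) := by
  have hA : 0 ≤ A := (abs_nonneg a).trans ha
  calc |a * c - b * d| ≤ |a * c| + |b * d| := abs_sub _ _
    _ = |a| * |c| + |b| * |d| := by rw [abs_mul, abs_mul]
    _ ≤ A * B + A * B := by gcongr
    _ = _ := by ring

lemma absDz (K : KK) {s : ℤ × ℤ × ℤ} (h : K.InS s) : |(K.Dz s : ℝ)| ≤ 4 * (K.l * K.L ^ 2) := by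
  have h1 : K.V s ^ 2 + K.W s ^ 2 ≤ 4 * K.L ^ 2 := by
    have := h.1; have := K.hδ1; nlinarith [sq_nonneg K.L]
  have : |K.V s ^ 2 + K.W s ^ 2 - K.U s ^ 2| ≤ 4 * K.L ^ 2 := by
    rw [abs_le]; constructor <;> nlinarith [h.2, sq_nonneg (K.V s), sq_nonneg (K.W s), sq_nonneg (K.U s)]
  rw [Deq, abs_mul, abs_of_pos K.lpos]
  nlinarith [K.lpos]

lemma absGz (K : KK) {s t : ℤ × ℤ × ℤ} (hs : K.InS s) (ht : K.InS t) :
    |(K.Gz s t : ℝ)| ≤ 48 * (K.l * K.L ^ 2 * K.X) := by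
  have hρ := K.ρpos; have hρL := K.ρL
  have w1 : (K.V s * K.W t - K.V t * K.W s) ^ 2 ≤ (8 * (K.ρ * K.L)) ^ 2 := by
    apply sq_le_sq'
    all_goals
      have := abs_le.mp (kk_wedge (K.V s) (K.V t) (K.W t) (K.W s) _ _ (K.absV hs) (K.absV ht) (K.absW ht) (K.absW hs))
      nlinarith
  have w2 : (K.V s * K.U t - K.V t * K.U s) ^ 2 ≤ (8 * (K.ρ * K.L)) ^ 2 := by
    apply sq_le_sq'
    all_goals
      have := abs_le.mp (kk_wedge (K.V s) (K.V t) (K.U t) (K.U s) _ _ (K.absV hs) (K.absV ht) (K.absU ht) (K.absU hs))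
      nlinarith
  have w3 : (K.W s * K.U t - K.W t * K.U s) ^ 2 ≤ (8 * (K.ρ * K.L)) ^ 2 := by
    apply sq_le_sq'
    all_goals
      have := abs_le.mp (kk_wedge (K.W s) (K.W t) (K.U t) (K.U s) _ _ (K.absW hs) (K.absW ht) (K.absU ht) (K.absU hs))
      nlinarith
  have h := K.Geq s t
  have hq := K.qpos; have hl := K.lpos
  have h2 : 4 * (K.q : ℝ) * |(K.Gz s t : ℝ)| ≤ K.l ^ 2 * (3 * (8 * (K.ρ * K.L)) ^ 2) := by
    have : 4 * (K.q : ℝ) * |(K.Gz s t : ℝ)| = |4 * (K.q : ℝ) * K.Gz s t| := by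
      rw [abs_mul, abs_of_pos (by positivity : (0:ℝ) < 4 * K.q)]
    rw [this, h, abs_mul, abs_of_pos (by positivity : (0:ℝ) < K.l ^ 2)]
    gcongr
    rw [abs_le]
    constructor <;> nlinarith [sq_nonneg (K.V s * K.W t - K.V t * K.W s), sq_nonneg (K.V s * K.U t - K.V t * K.U s), sq_nonneg (K.W s * K.U t - K.W t * K.U s), sq_nonneg (8 * (K.ρ * K.L))]
  have h3 : K.l ^ 2 * (3 * (8 * (K.ρ * K.L)) ^ 2) = 4 * K.q * (48 * (K.l * K.L ^ 2 * K.X)) := by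
    have := K.qX
    linear_combination (-192 * K.l * K.L ^ 2) * this
  rw [h3] at h2
  exact le_of_mul_le_mul_left h2 (by positivity)

lemma absdet (K : KK) {s t u : ℤ × ℤ × ℤ} (hs : K.InS s) (ht : K.InS t) (hu : K.InS u) :
    |(kkdet3 s t u : ℝ)| ≤ 24 * (K.X * K.L) := by
  have hρ := K.ρpos; have hρL := K.ρL; have hL := K.hL
  have w1 := kk_wedge (K.W t) (K.W u) (K.U u) (K.U t) _ _ (K.absW ht) (K.absW hu) (K.absU hu) (K.absU ht)
  have w2 := kk_wedge (K.V t) (K.V u) (K.U u) (K.U t) _ _ (K.absV ht) (K.absV hu) (K.absU hu) (K.absU ht)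
  have w3 := kk_wedge (K.V t) (K.V u) (K.W u) (K.W t) _ _ (K.absV ht) (K.absV hu) (K.absW hu) (K.absW ht)
  have h := K.det3eq s t u
  have hb : |2 * ((K.q:ℝ) / K.l) * kkdet3 s t u| ≤ 48 * (K.ρ ^ 2 * K.L) := by
    rw [← h]
    calc _ ≤ |K.V s * (K.W t * K.U u - K.U t * K.W u)|
          + |K.W s * (K.V t * K.U u - K.U t * K.V u)| + |K.U s * (K.V t * K.W u - K.W t * K.V u)| :=
          (abs_add_le _ _).trans (by gcongr; exact abs_sub _ _)
      _ = |K.V s| * |K.W t * K.U u - K.W u * K.U t| + |K.W s| * |K.V t * K.U u - K.V u * K.U t|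
          + |K.U s| * |K.V t * K.W u - K.V u * K.W t| := by
          rw [abs_mul, abs_mul, abs_mul, mul_comm (K.U t) (K.W u), mul_comm (K.U t) (K.V u),
            mul_comm (K.W t) (K.V u)]
      _ ≤ (2 * K.ρ) * (2 * (2 * K.ρ * (2 * K.L))) + (2 * K.ρ) * (2 * (2 * K.ρ * (2 * K.L)))
          + (2 * K.L) * (2 * (2 * K.ρ * (2 * K.ρ))) := by
          gcongr
          · exact K.absV hs
          · exact K.absW hs
          · exact K.absU hs
      _ = _ := by ring
  have hq := K.qpos; have hl := K.lpos
  rw [abs_mul, abs_of_pos (by positivity : (0:ℝ) < 2 * (K.q / K.l))] at hb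
  have h3 : 48 * (K.ρ ^ 2 * K.L) = 2 * (K.q / K.l) * (24 * (K.X * K.L)) := by
    have := K.qX
    field_simp
    linear_combination (-48) * this
  rw [h3] at hb
  exact le_of_mul_le_mul_left hb (by positivity)

end KK

lemma kk_dvd (q : ℕ) (hsf : Squarefree q) (m0 m1 m2 : ℤ) (h1 : (q:ℤ) ∣ m1 ^ 2 - m0 ^ 2)
    (h2 : (q:ℤ) ∣ m2 ^ 2 - m0 ^ 2) (hg : Int.gcd q (m1 - m0) = Int.gcd q (m2 - m0)) :
    (q:ℤ) ∣ m1 - m2 := by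
  rw [Int.natCast_dvd]
  rw [← Nat.prod_primeFactors_of_squarefree hsf]
  refine Finset.prod_primes_dvd _ (fun p hp => (Nat.prime_of_mem_primeFactors hp).prime) (fun p hp => ?_)
  have hp' := Nat.prime_of_mem_primeFactors hp
  have hpq : (p:ℤ) ∣ q := by exact_mod_cast Nat.dvd_of_mem_primeFactors hp
  rw [← Int.natCast_dvd]
  have hpi : Prime (p:ℤ) := Nat.prime_iff_prime_int.mp hp'
  have a1 : (p:ℤ) ∣ (m1 - m0) * (m1 + m0) := by
    have := hpq.trans h1; rwa [show m1 ^ 2 - m0 ^ 2 = (m1 - m0) * (m1 + m0) by ring] at this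
  have a2 : (p:ℤ) ∣ (m2 - m0) * (m2 + m0) := by
    have := hpq.trans h2; rwa [show m2 ^ 2 - m0 ^ 2 = (m2 - m0) * (m2 + m0) by ring] at this
  have key : (p:ℤ) ∣ m1 - m0 ↔ (p:ℤ) ∣ m2 - m0 := by
    have e : ∀ m : ℤ, (p:ℤ) ∣ m ↔ (p:ℤ) ∣ (Int.gcd q m : ℤ) := fun m => by
      rw [Int.dvd_coe_gcd_iff]; simp [hpq]
    rw [e, e (m2 - m0), hg]
  by_cases h : (p:ℤ) ∣ m1 - m0
  · have := dvd_sub h (key.mp h)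
    rwa [show m1 - m0 - (m2 - m0) = m1 - m2 by ring] at this
  · have b1 := (hpi.dvd_or_dvd a1).resolve_left h
    have b2 := (hpi.dvd_or_dvd a2).resolve_left (fun h' => h (key.mpr h'))
    have := dvd_sub b1 b2
    rwa [show m1 + m0 - (m2 + m0) = m1 - m2 by ring] at this

namespace KK

lemma Dz_mod (K : KK) {s t : ℤ × ℤ × ℤ} (h : K.Dz s = K.Dz t) : (K.q:ℤ) ∣ s.1 ^ 2 - t.1 ^ 2 := by
  have h1 : (K.q:ℤ) ∣ (K.l:ℤ) * (s.1 ^ 2 - t.1 ^ 2) := by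
    refine ⟨4 * (t.2.1 * t.2.2 - s.2.1 * s.2.2), ?_⟩
    simp only [Dz] at h
    linear_combination h
  exact IsCoprime.dvd_of_dvd_mul_left (Nat.isCoprime_iff_coprime.mpr K.hcop) h1

lemma countR (K : KK) (F : Finset (ℤ × ℤ × ℤ)) (n : ℤ)
    (hF : ∀ s ∈ F, K.InS s ∧ s.2.2 ≠ 0 ∧ K.Dz s = n) :
    (F.card : ℝ) ≤ 1024 * K.q.divisors.card * (1 + K.X) := by
  classical
  have hX := K.Xpos
  rcases F.eq_empty_or_nonempty with rfl | ⟨s0, hs0⟩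
  · simp; positivity
  have hq := K.qpos; have hl := K.lpos; have hy := K.hy; have hρ := K.ρpos
  set u : ℝ := √(-(n / K.l)) with hu
  have hu0 : 0 ≤ u := Real.sqrt_nonneg _
  have hUabs : ∀ s ∈ F, u ≤ |K.U s| ∧ |K.U s| ≤ u + 2 * K.ρ := by
    intro s hs
    obtain ⟨hin, -, hD⟩ := hF s hs
    have hD' := K.Deq s
    rw [hD] at hD'
    have e1 : K.V s ^ 2 + K.W s ^ 2 - K.U s ^ 2 = n / K.l := by rw [hD']; field_simp
    have e2 := hin.1
    have e3 := K.ρsq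
    constructor
    · apply Real.sqrt_le_iff.mpr
      refine ⟨abs_nonneg _, ?_⟩
      rw [sq_abs]; nlinarith [sq_nonneg (K.V s), sq_nonneg (K.W s)]
    · apply abs_le_of_sq_le_sq _ (by positivity)
      rcases le_total 0 (-((n:ℝ) / K.l)) with h | h
      · have : u ^ 2 = -(n / K.l) := Real.sq_sqrt h
        nlinarith [mul_nonneg hu0 hρ.le]
      · nlinarith [mul_nonneg hu0 hρ.le, sq_nonneg u]
  have main := kk_card_fiber F (K.q.divisors ×ˢ (Finset.univ : Finset Bool))
    (fun s => (Int.gcd K.q (s.1 - s0.1), decide (0 ≤ K.U s))) ?_ (512 * K.X + 8) ?_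
  · rw [Finset.card_product] at main
    simp only [Finset.card_univ, Fintype.card_bool] at main
    push_cast at main
    have hd : (0:ℝ) ≤ K.q.divisors.card := by positivity
    nlinarith [mul_nonneg hd hX.le]
  · intro s hs
    simp only [Finset.mem_product, Nat.mem_divisors, Finset.mem_univ, and_true]
    exact ⟨by exact_mod_cast Int.gcd_dvd_left (K.q:ℤ) (s.1 - s0.1), K.hq.ne'⟩
  · rintro ⟨e, sg⟩ -
    set G := F.filter (fun s => (Int.gcd K.q (s.1 - s0.1), decide (0 ≤ K.U s)) = (e, sg)) with hG
    have hGF : ∀ s ∈ G, s ∈ F ∧ Int.gcd K.q (s.1 - s0.1) = e ∧ decide (0 ≤ K.U s) = sg := by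
      intro s hs
      rw [hG, Finset.mem_filter] at hs
      simpa using hs
    have hh : 0 < √((K.q:ℝ) / K.l) / 2 := by positivity
    have hh2 : (√((K.q:ℝ) / K.l)) ^ 2 = (K.q:ℝ) / K.l := Real.sq_sqrt (by positivity)
    have b := kk_box G (fun s => K.V s) (fun s => K.U s + K.W s) (√((K.q:ℝ) / K.l) / 2) (8 * K.ρ)
      (- (2 * K.ρ)) (if sg then u - 2 * K.ρ else - u - 4 * K.ρ) hh (by positivity) ?_ ?_ ?_
    · refine b.trans ?_
      have hz : 8 * K.ρ / (√((K.q:ℝ) / K.l) / 2) = 16 * (K.ρ / √((K.q:ℝ) / K.l)) := by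
        field_simp; ring
      have hz2 : (K.ρ / √((K.q:ℝ) / K.l)) ^ 2 = K.X := by
        rw [div_pow, hh2]
        have := K.qX
        field_simp
        linarith
      rw [hz]
      nlinarith [sq_nonneg (16 * (K.ρ / √((K.q:ℝ) / K.l)) - 2)]
    · intro s hs
      have := abs_le.mp (K.absV (hF s (hGF s hs).1).1)
      constructor <;> linarith [this.1, this.2]
    · intro s hs
      obtain ⟨h1, h2, h3⟩ := hGF s hs
      have hw := abs_le.mp (K.absW (hF s h1).1)
      have hU := hUabs s h1
      cases sg
      · have : K.U s < 0 := by simpa using h3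
        rw [abs_of_neg this] at hU
        simp only [Bool.false_eq_true, if_false]
        constructor <;> linarith [hw.1, hw.2, hU.1, hU.2]
      · have : 0 ≤ K.U s := by simpa using h3
        rw [abs_of_nonneg this] at hU
        simp only [if_true]
        constructor <;> linarith [hw.1, hw.2, hU.1, hU.2]
    · intro s hs t ht hst
      obtain ⟨hsF, hsg, -⟩ := hGF s hs
      obtain ⟨htF, htg, -⟩ := hGF t ht
      have hDs := (hF s hsF).2.2
      have hDt := (hF t htF).2.2
      have hD0 := (hF s0 hs0).2.2
      obtain ⟨k, hk⟩ := kk_dvd K.q K.hsf s0.1 s.1 t.1 (K.Dz_mod (hDs.trans hD0.symm))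
        (K.Dz_mod (hDt.trans hD0.symm)) (hsg.trans htg.symm)
      have hne : 2 * (s.2.2 - t.2.2) ≠ 0 ∨ -k ≠ 0 := by
        by_contra hcon
        push Not at hcon
        obtain ⟨c1, c2⟩ := hcon
        have k0 : k = 0 := by omega
        have cc : s.2.2 = t.2.2 := by omega
        have mm : s.1 = t.1 := by rw [k0] at hk; linarith
        have hD := hDs.trans hDt.symm
        simp only [Dz] at hD
        rw [mm, cc] at hD
        have hc := (hF t htF).2.1
        have hq' : (K.q:ℤ) ≠ 0 := by exact_mod_cast K.hq.ne'
        have : (4 * (K.q:ℤ) * t.2.2) * (s.2.1 - t.2.1) = 0 := by linear_combination hD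
        have bb : s.2.1 - t.2.1 = 0 := by
          rcases mul_eq_zero.mp this with h | h
          · exfalso; apply hc; simpa [K.hq.ne'] using h
          · exact h
        apply hst
        exact Prod.ext mm (Prod.ext (by linarith) cc)
      have hm := K.min1 _ _ hne
      have hkr : (s.1:ℝ) - t.1 = K.q * k := by exact_mod_cast hk
      have e : (K.V s - K.V t) ^ 2 + (K.U s + K.W s - (K.U t + K.W t)) ^ 2
          = K.q ^ 2 * ((((2 * (s.2.2 - t.2.2) : ℤ):ℝ) * K.x + ((-k : ℤ):ℝ)) ^ 2
            + (((2 * (s.2.2 - t.2.2) : ℤ):ℝ) * K.y) ^ 2) := by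
        have e1 : K.V s - K.V t = K.q * (k - 2 * (s.2.2 - t.2.2) * K.x) := by
          simp only [V]; linear_combination hkr
        have e2 : K.U s + K.W s - (K.U t + K.W t) = K.q * (2 * (s.2.2 - t.2.2) * K.y) := by
          simp only [U, W]; ring
        rw [e1, e2]; push_cast; ring
      show _ ≤ (K.V s - K.V t) ^ 2 + (K.U s + K.W s - (K.U t + K.W t)) ^ 2
      rw [e]
      calc 2 * (√((K.q:ℝ) / K.l) / 2) ^ 2 = (K.q:ℝ) ^ 2 * (1 / (2 * ((K.q:ℝ) * K.l))) := by
            rw [div_pow, hh2]; field_simp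
        _ ≤ _ := by gcongr

lemma one_le_d (K : KK) : (1:ℝ) ≤ K.q.divisors.card := by
  have : 0 < K.q.divisors.card := Finset.card_pos.mpr ⟨1, by simp [K.hq.ne']⟩
  exact_mod_cast this

lemma countM (K : KK) (F : Finset (ℤ × ℤ × ℤ)) (hbig : 1 ≤ 36 * (K.l * K.L ^ 2))
    (hF : ∀ s ∈ F, K.InS s ∧ s.2.2 ≠ 0) :
    (F.card : ℝ) ≤ 9000 * K.q.divisors.card * (√K.l * K.L) * (1 + K.X) := by
  classical
  have hX := K.Xpos; have hL := K.hL; have hl := K.lpos; have hd := K.one_le_d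
  set R : ℝ := √K.l * K.L with hR
  have hR0 : 0 < R := by positivity
  have hR2 : R ^ 2 = K.l * K.L ^ 2 := by rw [hR, mul_pow, Real.sq_sqrt hl.le]
  have hR1 : 1 ≤ 6 * R := by nlinarith
  have hLR : K.L ≤ R := by
    have : 1 ≤ √(K.l:ℝ) := Real.one_le_sqrt.mpr (by exact_mod_cast K.hl)
    rw [hR]; nlinarith
  have hDR : R * (1 + K.X) ≤ K.q.divisors.card * R * (1 + K.X) := by
    have : 0 ≤ R * (1 + K.X) := by positivity
    nlinarith
  by_cases hG : ∀ v ∈ F, ∀ w ∈ F, K.Gz v w = 0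
  · have hz := kk_sqclass (F.image K.Dz) (2 * R) (by positivity) ?_ ?_
    · have := kk_card_fiber F (F.image K.Dz) K.Dz (fun a ha => Finset.mem_image_of_mem _ ha)
        (1024 * K.q.divisors.card * (1 + K.X)) ?_
      · calc (F.card:ℝ) ≤ _ := this
          _ ≤ 1024 * K.q.divisors.card * (1 + K.X) * (8 * R) := by gcongr; linarith
          _ ≤ _ := by nlinarith [hDR, mul_pos hR0 (by linarith : 0 < 1 + K.X)]
      · intro n _
        apply K.countR _ n
        intro s hs
        rw [Finset.mem_filter] at hs
        exact ⟨(hF s hs.1).1, (hF s hs.1).2, hs.2⟩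
    · intro n hn
      obtain ⟨s, hs, rfl⟩ := Finset.mem_image.mp hn
      have := K.absDz (hF s hs).1
      nlinarith
    · intro n hn n' hn'
      obtain ⟨s, hs, rfl⟩ := Finset.mem_image.mp hn
      obtain ⟨t, ht, rfl⟩ := Finset.mem_image.mp hn'
      refine ⟨K.Bz s t, ?_⟩
      have := K.DBG s t
      rw [hG s hs t ht] at this
      linarith
  push Not at hG
  obtain ⟨v0, hv0, w0, hw0, hG0⟩ := hG
  by_cases hT : ∀ v ∈ F, ∀ w ∈ F, ∀ u ∈ F, kkdet3 v w u = 0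
  · obtain ⟨⟨v, w⟩, hvw, hmax⟩ := Finset.exists_max_image (F ×ˢ F) (fun p => |K.Gz p.1 p.2|)
      ⟨(v0, w0), Finset.mk_mem_product hv0 hw0⟩
    rw [Finset.mem_product] at hvw
    obtain ⟨hv, hw⟩ := hvw
    simp only at hv hw hmax
    have hg0 : K.Gz v w ≠ 0 := by
      have := hmax (v0, w0) (Finset.mk_mem_product hv0 hw0)
      have h2 := abs_pos.mpr hG0
      exact abs_pos.mp (h2.trans_le this)
    obtain ⟨κ, u, hκd, p1, p2, p3, hp1, hp2, hp3⟩ : ∃ κ : ℤ, ∃ u : ℤ × ℤ × ℤ, kkdet3 v w u = κ ∧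
        ∃ p1 p2 p3 : ℤ, v.1 * w.2.1 - w.1 * v.2.1 = κ * p1 ∧ v.1 * w.2.2 - w.1 * v.2.2 = κ * p2 ∧
          v.2.1 * w.2.2 - w.2.1 * v.2.2 = κ * p3 := by
      set a := v.1 * w.2.1 - w.1 * v.2.1 with ha
      set b := v.1 * w.2.2 - w.1 * v.2.2 with hb
      set c := v.2.1 * w.2.2 - w.2.1 * v.2.2 with hc
      have e1 := Int.gcd_eq_gcd_ab b c
      have e2 := Int.gcd_eq_gcd_ab a (Int.gcd b c)
      have d1 : (Int.gcd a (Int.gcd b c) : ℤ) ∣ a := Int.gcd_dvd_left _ _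
      have d2 : (Int.gcd a (Int.gcd b c) : ℤ) ∣ (Int.gcd b c : ℤ) := Int.gcd_dvd_right _ _
      obtain ⟨p1, hp1⟩ := d1
      obtain ⟨p2, hp2⟩ := d2.trans (Int.gcd_dvd_left b c)
      obtain ⟨p3, hp3⟩ := d2.trans (Int.gcd_dvd_right b c)
      refine ⟨(Int.gcd a (Int.gcd b c) : ℤ),
        (Int.gcdB a (Int.gcd b c) * Int.gcdB b c, - (Int.gcdB a (Int.gcd b c) * Int.gcdA b c), Int.gcdA a (Int.gcd b c)),
        ?_, p1, p2, p3, hp1, hp2, hp3⟩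
      rw [e2]
      generalize Int.gcdA a (Int.gcd b c) = A at *
      generalize Int.gcdB a (Int.gcd b c) = B at *
      generalize Int.gcdA b c = A' at *
      generalize Int.gcdB b c = B' at *
      rw [e1, ha, hb, hc]
      simp only [kkdet3]
      ring
    have hGκ : K.Gz v w = κ ^ 2 * (K.l * p1 * p2 - K.q * p3 ^ 2) := by
      simp only [Gz]; rw [hp1, hp2, hp3]; ring
    have hκ0 : κ ≠ 0 := by rintro rfl; apply hg0; rw [hGκ]; ring
    have hκG : κ ^ 2 ≤ |K.Gz v w| := by
      have hne : K.l * p1 * p2 - K.q * p3 ^ 2 ≠ 0 := by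
        intro h; apply hg0; rw [hGκ, h]; ring
      rw [hGκ, abs_mul, abs_of_nonneg (sq_nonneg κ)]
      have := Int.one_le_abs hne
      nlinarith [sq_nonneg κ]
    have hcr := kk_count3 v w u (by rw [hκd]; exact hκ0) F ?_ ?_ ?_
    · rw [hκd] at hcr
      have hb := K.absGz (hF v hv).1 (hF w hw).1
      have hb2 : (κ:ℝ) ^ 2 ≤ |(K.Gz v w : ℝ)| := by exact_mod_cast hκG
      have hb3 : |(κ:ℝ)| ≤ 7 * R * (1 + K.X) := by
        apply abs_le_of_sq_le_sq _ (by positivity)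
        rw [← hR2] at hb
        have hpos : 0 < R ^ 2 := by positivity
        have : R ^ 2 * (48 * K.X) ≤ R ^ 2 * (49 * (1 + K.X) ^ 2) := by
          apply mul_le_mul_of_nonneg_left _ hpos.le; nlinarith
        nlinarith
      nlinarith [mul_pos hR0 (by linarith : 0 < 1 + K.X)]
    · intro s hs
      have hdet := hT v hv w hw s hs
      have key : (kkdet3 v w u) ^ 2 * K.Gz s w = (kkdet3 s w u) ^ 2 * K.Gz v w := by
        have q1 : kkdet3 v w u * (s.1 * w.2.1 - w.1 * s.2.1) = kkdet3 s w u * (v.1 * w.2.1 - w.1 * v.2.1) := by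
          have : kkdet3 v w u * (s.1 * w.2.1 - w.1 * s.2.1) - kkdet3 s w u * (v.1 * w.2.1 - w.1 * v.2.1)
            = kkdet3 v w s * (u.1 * w.2.1 - w.1 * u.2.1) := by simp only [kkdet3]; ring
          rw [hdet] at this; linarith
        have q2 : kkdet3 v w u * (s.1 * w.2.2 - w.1 * s.2.2) = kkdet3 s w u * (v.1 * w.2.2 - w.1 * v.2.2) := by
          have : kkdet3 v w u * (s.1 * w.2.2 - w.1 * s.2.2) - kkdet3 s w u * (v.1 * w.2.2 - w.1 * v.2.2)
            = kkdet3 v w s * (u.1 * w.2.2 - w.1 * u.2.2) := by simp only [kkdet3]; ring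
          rw [hdet] at this; linarith
        have q3 : kkdet3 v w u * (s.2.1 * w.2.2 - w.2.1 * s.2.2) = kkdet3 s w u * (v.2.1 * w.2.2 - w.2.1 * v.2.2) := by
          have : kkdet3 v w u * (s.2.1 * w.2.2 - w.2.1 * s.2.2) - kkdet3 s w u * (v.2.1 * w.2.2 - w.2.1 * v.2.2)
            = kkdet3 v w s * (u.2.1 * w.2.2 - w.2.1 * u.2.2) := by simp only [kkdet3]; ring
          rw [hdet] at this; linarith
        simp only [Gz]
        calc _ = K.l * (kkdet3 v w u * (s.1 * w.2.1 - w.1 * s.2.1)) * (kkdet3 v w u * (s.1 * w.2.2 - w.1 * s.2.2))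
              - K.q * (kkdet3 v w u * (s.2.1 * w.2.2 - w.2.1 * s.2.2)) ^ 2 := by ring
          _ = _ := by rw [q1, q2, q3]; ring
      have hm := hmax (s, w) (Finset.mk_mem_product hs hw)
      simp only at hm
      have key2 : (kkdet3 v w u) ^ 2 * |K.Gz s w| = (kkdet3 s w u) ^ 2 * |K.Gz v w| := by
        have := congrArg abs key
        rwa [abs_mul, abs_mul, abs_pow, abs_pow, sq_abs, sq_abs] at this
      have hgp := abs_pos.mpr hg0
      rw [← sq_le_sq]
      by_contra hlt
      push Not at hlt
      nlinarith [sq_nonneg (kkdet3 v w u)]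
    · intro s hs
      have hdet := hT v hv w hw s hs
      have key : (kkdet3 v w u) ^ 2 * K.Gz v s = (kkdet3 v s u) ^ 2 * K.Gz v w := by
        have q1 : kkdet3 v w u * (v.1 * s.2.1 - s.1 * v.2.1) = kkdet3 v s u * (v.1 * w.2.1 - w.1 * v.2.1) := by
          have : kkdet3 v w u * (v.1 * s.2.1 - s.1 * v.2.1) - kkdet3 v s u * (v.1 * w.2.1 - w.1 * v.2.1)
            = kkdet3 v w s * (v.1 * u.2.1 - u.1 * v.2.1) := by simp only [kkdet3]; ring
          rw [hdet] at this; linarith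
        have q2 : kkdet3 v w u * (v.1 * s.2.2 - s.1 * v.2.2) = kkdet3 v s u * (v.1 * w.2.2 - w.1 * v.2.2) := by
          have : kkdet3 v w u * (v.1 * s.2.2 - s.1 * v.2.2) - kkdet3 v s u * (v.1 * w.2.2 - w.1 * v.2.2)
            = kkdet3 v w s * (v.1 * u.2.2 - u.1 * v.2.2) := by simp only [kkdet3]; ring
          rw [hdet] at this; linarith
        have q3 : kkdet3 v w u * (v.2.1 * s.2.2 - s.2.1 * v.2.2) = kkdet3 v s u * (v.2.1 * w.2.2 - w.2.1 * v.2.2) := by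
          have : kkdet3 v w u * (v.2.1 * s.2.2 - s.2.1 * v.2.2) - kkdet3 v s u * (v.2.1 * w.2.2 - w.2.1 * v.2.2)
            = kkdet3 v w s * (v.2.1 * u.2.2 - u.2.1 * v.2.2) := by simp only [kkdet3]; ring
          rw [hdet] at this; linarith
        simp only [Gz]
        calc _ = K.l * (kkdet3 v w u * (v.1 * s.2.1 - s.1 * v.2.1)) * (kkdet3 v w u * (v.1 * s.2.2 - s.1 * v.2.2))
              - K.q * (kkdet3 v w u * (v.2.1 * s.2.2 - s.2.1 * v.2.2)) ^ 2 := by ring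
          _ = _ := by rw [q1, q2, q3]; ring
      have hm := hmax (v, s) (Finset.mk_mem_product hv hs)
      simp only at hm
      have key2 : (kkdet3 v w u) ^ 2 * |K.Gz v s| = (kkdet3 v s u) ^ 2 * |K.Gz v w| := by
        have := congrArg abs key
        rwa [abs_mul, abs_mul, abs_pow, abs_pow, sq_abs, sq_abs] at this
      have hgp := abs_pos.mpr hg0
      rw [← sq_le_sq]
      by_contra hlt
      push Not at hlt
      nlinarith [sq_nonneg (kkdet3 v w u)]
    · intro s hs
      rw [hT v hv w hw s hs]; simp
  · push Not at hT
    obtain ⟨v1, hv1, w1, hw1, u1, hu1, hd1⟩ := hT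
    obtain ⟨⟨v, w, u⟩, hvw, hmax⟩ := Finset.exists_max_image (F ×ˢ F ×ˢ F) (fun p => |kkdet3 p.1 p.2.1 p.2.2|)
      ⟨(v1, w1, u1), Finset.mk_mem_product hv1 (Finset.mk_mem_product hw1 hu1)⟩
    simp only [Finset.mem_product] at hvw
    obtain ⟨hv, hw, hu⟩ := hvw
    have hd0 : kkdet3 v w u ≠ 0 := by
      have := hmax (v1, w1, u1) (Finset.mk_mem_product hv1 (Finset.mk_mem_product hw1 hu1))
      exact abs_pos.mp ((abs_pos.mpr hd1).trans_le this)
    have hcr := kk_count3 v w u hd0 F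
      (fun s hs => hmax (s, w, u) (Finset.mk_mem_product hs (Finset.mk_mem_product hw hu)))
      (fun s hs => hmax (v, s, u) (Finset.mk_mem_product hv (Finset.mk_mem_product hs hu)))
      (fun s hs => hmax (v, w, s) (Finset.mk_mem_product hv (Finset.mk_mem_product hw hs)))
    have hb := K.absdet (hF v hv).1 (hF w hw).1 (hF u hu).1
    have : K.X * K.L ≤ R * (1 + K.X) := by nlinarith
    nlinarith [mul_pos hR0 (by linarith : 0 < 1 + K.X)]

end KK

namespace KK

lemma b_range (K : KK) {s : ℤ × ℤ × ℤ} (h : K.InS s) (hc : s.2.2 = 0) :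
    - (K.l * (s.1 * K.x)) - 2 * (K.l * K.y * K.ρ) ≤ s.2.1 ∧
      (s.2.1 : ℝ) ≤ - (K.l * (s.1 * K.x)) - 2 * (K.l * K.y * K.ρ) + 4 * (K.l * K.y * K.ρ) := by
  have hW := abs_le.mp (K.absW h)
  have hl := K.lpos; have hy := K.hy
  have e : (s.2.1 : ℝ) = K.l * K.y * K.W s - K.l * (s.1 * K.x) := by
    simp only [W, T, hc]; push_cast; field_simp; ring
  have hly : 0 < K.l * K.y := by positivity
  rw [e]
  constructor <;> nlinarith [hW.1, hW.2]

lemma count0 (K : KK) (F : Finset (ℤ × ℤ × ℤ)) (hF : ∀ s ∈ F, K.InS s ∧ s.2.2 = 0) :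
    (F.card : ℝ) ≤ (1 + 4 * (K.l * K.y * K.ρ)) * (1 + 4 * K.ρ) := by
  classical
  have hl := K.lpos; have hy := K.hy; have hρ := K.ρpos
  have := kk_card_fiber F (Finset.Icc ⌈-(2 * K.ρ)⌉ ⌊-(2 * K.ρ) + 4 * K.ρ⌋) (fun s => s.1) ?_
    (1 + 4 * (K.l * K.y * K.ρ)) ?_
  · refine this.trans ?_
    have h2 := kk_card_Icc (-(2 * K.ρ)) (4 * K.ρ) (by positivity)
    have : (0:ℝ) ≤ 1 + 4 * (K.l * K.y * K.ρ) := by positivity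
    apply mul_le_mul_of_nonneg_left _ this
    linarith
  · intro s hs
    obtain ⟨h1, h2⟩ := hF s hs
    have hV := abs_le.mp (K.absV h1)
    have : K.V s = s.1 := by simp [V, h2]
    rw [this] at hV
    rw [Finset.mem_Icc]
    exact ⟨Int.ceil_le.mpr hV.1, Int.le_floor.mpr (by linarith [hV.2])⟩
  · intro m _
    have := kk_fib (F.filter (fun s => s.1 = m)) (fun s => s.2.1) ?_
      (- (K.l * (m * K.x)) - 2 * (K.l * K.y * K.ρ)) (4 * (K.l * K.y * K.ρ)) (by positivity) ?_
    · linarith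
    · intro s hs t ht hst
      simp only [Finset.coe_filter, Set.mem_ofPred_eq] at hs ht
      exact Prod.ext (hs.2.trans ht.2.symm) (Prod.ext hst ((hF s hs.1).2.trans (hF t ht.1).2.symm))
    · intro s hs
      rw [Finset.mem_filter] at hs
      have := K.b_range (hF s hs.1).1 (hF s hs.1).2
      rw [hs.2] at this
      exact this

lemma countR0 (K : KK) (F : Finset (ℤ × ℤ × ℤ)) (n : ℤ)
    (hF : ∀ s ∈ F, K.InS s ∧ s.2.2 = 0 ∧ K.Dz s = n) :
    (F.card : ℝ) ≤ 2 * (1 + 4 * (K.l * K.y * K.ρ)) := by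
  classical
  have hl := K.lpos; have hy := K.hy; have hρ := K.ρpos
  rcases F.eq_empty_or_nonempty with rfl | ⟨s0, hs0⟩
  · simp; positivity
  have := kk_card_fiber F ({s0.1, -s0.1} : Finset ℤ) (fun s => s.1) ?_
    (1 + 4 * (K.l * K.y * K.ρ)) ?_
  · refine this.trans ?_
    have h2 : (({s0.1, -s0.1} : Finset ℤ).card : ℝ) ≤ 2 := by exact_mod_cast Finset.card_le_two
    have : (0:ℝ) ≤ 1 + 4 * (K.l * K.y * K.ρ) := by positivity
    nlinarith
  · intro s hs
    obtain ⟨h1, h2, h3⟩ := hF s hs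
    obtain ⟨g1, g2, g3⟩ := hF s0 hs0
    have h := h3.trans g3.symm
    simp only [Dz, h2, g2] at h
    have hl' : (K.l : ℤ) ≠ 0 := by exact_mod_cast K.hl.ne'
    have e : s.1 ^ 2 = s0.1 ^ 2 := by
      apply mul_left_cancel₀ hl'; linarith
    simp only [Finset.mem_insert, Finset.mem_singleton]
    exact sq_eq_sq_iff_eq_or_eq_neg.mp e
  · intro m _
    have := kk_fib (F.filter (fun s => s.1 = m)) (fun s => s.2.1) ?_
      (- (K.l * (m * K.x)) - 2 * (K.l * K.y * K.ρ)) (4 * (K.l * K.y * K.ρ)) (by positivity) ?_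
    · linarith
    · intro s hs t ht hst
      simp only [Finset.coe_filter, Set.mem_ofPred_eq] at hs ht
      exact Prod.ext (hs.2.trans ht.2.symm) (Prod.ext hst ((hF s hs.1).2.1.trans (hF t ht.1).2.1.symm))
    · intro s hs
      rw [Finset.mem_filter] at hs
      have := K.b_range (hF s hs.1).1 (hF s hs.1).2.1
      rw [hs.2] at this
      exact this

noncomputable def A (K : KK) : ℝ := 1 + √K.l * K.y * √K.δ + √K.l * K.y * K.δ * K.L + K.X
noncomputable def B (K : KK) : ℝ := 1 + √K.l * K.y * √K.δ + √K.l * K.y * √K.δ * K.L + K.X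
noncomputable def R (K : KK) : ℝ := √K.l * K.L

lemma Rpos (K : KK) : 0 < K.R := mul_pos (Real.sqrt_pos.mpr K.lpos) K.hL
lemma Rsq (K : KK) : K.R ^ 2 = K.l * K.L ^ 2 := by
  rw [R, mul_pow, Real.sq_sqrt K.lpos.le]
lemma LR (K : KK) : K.L ≤ K.R := by
  have : 1 ≤ √(K.l:ℝ) := Real.one_le_sqrt.mpr (by exact_mod_cast K.hl)
  have := K.hL
  rw [R]; nlinarith
lemma lyρ (K : KK) : K.l * K.y * K.ρ = K.R * (√K.l * K.y * √K.δ) := by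
  have := Real.mul_self_sqrt K.lpos.le
  rw [R, ρ]
  linear_combination (-K.y * √K.δ * K.L) * this
lemma aux_nonneg (K : KK) : 0 ≤ √K.l * K.y * √K.δ ∧ 0 ≤ √K.l * K.y * K.δ * K.L ∧
    √K.l * K.y * K.δ * K.L ≤ √K.l * K.y * √K.δ * K.L := by
  have := K.hy; have := K.hL; have := K.hδ
  refine ⟨by positivity, by positivity, ?_⟩
  have h1 : √K.δ ≤ 1 := Real.sqrt_le_one.mpr K.hδ1
  have h2 : K.δ ≤ √K.δ := by
    have := Real.mul_self_sqrt K.hδ.le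
    nlinarith [Real.sqrt_nonneg K.δ]
  gcongr
lemma AB (K : KK) : K.A ≤ K.B := by
  have := K.aux_nonneg; unfold A B; linarith [this.2.2]
lemma A1 (K : KK) : 1 ≤ K.A := by
  have h := K.aux_nonneg; have := K.Xpos; unfold A; linarith [h.1, h.2.1]
lemma XA (K : KK) : 1 + K.X ≤ K.A := by
  have h := K.aux_nonneg; have := K.Xpos; unfold A; linarith [h.1, h.2.1]

lemma est0 (K : KK) (h6 : 1 ≤ 6 * K.R) :
    (1 + 4 * (K.l * K.y * K.ρ)) * (1 + 4 * K.ρ) ≤ 16 * (K.R * K.A) := by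
  have h1 := K.lyρ
  have h2 : K.l * K.y * K.ρ * K.ρ = K.R * (√K.l * K.y * K.δ * K.L) := by
    rw [h1, ρ]
    have := Real.mul_self_sqrt K.hδ.le
    linear_combination (K.R * √K.l * K.y * K.L) * this
  have h3 := K.ρL.trans K.LR
  have h4 := K.aux_nonneg
  have h5 := K.Rpos
  have h7 := K.Xpos
  have e : (1 + 4 * (K.l * K.y * K.ρ)) * (1 + 4 * K.ρ) = 1 + 4 * K.ρ + 4 * (K.l * K.y * K.ρ)
    + 16 * (K.l * K.y * K.ρ * K.ρ) := by ring
  rw [e, h2, h1]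
  unfold A
  nlinarith [mul_nonneg h5.le h4.1, mul_nonneg h5.le h4.2.1, mul_pos h5 h7]

lemma est1 (K : KK) : K.L * (1 + 4 * (K.l * K.y * K.ρ)) ≤ 4 * (K.R * K.B) := by
  have h1 := K.lyρ
  have h4 := K.aux_nonneg
  have h5 := K.Rpos
  have h7 := K.Xpos
  have h8 := K.LR
  rw [h1]; unfold B
  nlinarith [mul_nonneg h5.le h4.1, mul_nonneg h5.le h4.2.1, mul_pos h5 h7]

lemma countS (K : KK) (F : Finset (ℤ × ℤ × ℤ)) (hbig : 1 ≤ 36 * (K.l * K.L ^ 2))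
    (hF : ∀ s ∈ F, K.InS s) : (F.card : ℝ) ≤ 9016 * K.q.divisors.card * (K.R * K.A) := by
  classical
  have h6 : 1 ≤ 6 * K.R := by have := K.Rsq; have := K.Rpos; nlinarith
  have hsplit := Finset.card_filter_add_card_filter_not (s := F) (fun s => s.2.2 = 0)
  have h0 := K.count0 (F.filter (fun s => s.2.2 = 0)) (fun s hs => by
    rw [Finset.mem_filter] at hs; exact ⟨hF s hs.1, hs.2⟩)
  have h1 := K.countM (F.filter (fun s => ¬ s.2.2 = 0)) hbig (fun s hs => by
    rw [Finset.mem_filter] at hs; exact ⟨hF s hs.1, hs.2⟩)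
  have hs : (F.card : ℝ) = ((F.filter (fun s => s.2.2 = 0)).card : ℝ) + ((F.filter (fun s => ¬ s.2.2 = 0)).card : ℝ) := by
    exact_mod_cast hsplit.symm
  have he := K.est0 h6
  have hd := K.one_le_d
  have hR := K.Rpos
  have hRA : 0 < K.R * K.A := mul_pos hR (by linarith [K.A1])
  have : 9000 * K.q.divisors.card * (√K.l * K.L) * (1 + K.X) ≤ 9000 * K.q.divisors.card * (K.R * K.A) := by
    rw [mul_assoc (9000 * (K.q.divisors.card : ℝ))]
    change _ * (K.R * (1 + K.X)) ≤ _
    have := K.XA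
    gcongr
  nlinarith

/-- pairs in `S` with the same discriminant -/
lemma countE (K : KK) (E : Finset ((ℤ × ℤ × ℤ) × (ℤ × ℤ × ℤ))) (hbig : 1 ≤ 36 * (K.l * K.L ^ 2))
    (hE : ∀ p ∈ E, K.InS p.1 ∧ K.InS p.2 ∧ K.Dz p.1 = K.Dz p.2) :
    K.L * (E.card : ℝ) ≤ 18464896 * (K.q.divisors.card : ℝ) ^ 2 * (K.R ^ 2 * (K.A * K.B)) := by
  classical
  have h6 : 1 ≤ 6 * K.R := by have := K.Rsq; have := K.Rpos; nlinarith
  have hd := K.one_le_d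
  have hR := K.Rpos
  have hA := K.A1
  have hAB := K.AB
  have hL := K.hL
  have hLR := K.LR
  have hXA := K.XA
  have hX := K.Xpos
  set E1 := E.filter (fun p => p.1.2.2 ≠ 0) with hE1
  set E2 := E.filter (fun p => p.2.2.2 ≠ 0) with hE2
  set E0 := E.filter (fun p => p.1.2.2 = 0 ∧ p.2.2.2 = 0) with hE0
  have hsub : E ⊆ E1 ∪ E2 ∪ E0 := by
    intro p hp
    simp only [hE1, hE2, hE0, Finset.mem_union, Finset.mem_filter]
    tauto
  have hcard : (E.card : ℝ) ≤ E1.card + E2.card + E0.card := by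
    have := (Finset.card_le_card hsub).trans ((Finset.card_union_le _ _).trans
      (Nat.add_le_add_right (Finset.card_union_le _ _) _))
    exact_mod_cast this
  have hS : ∀ f : (ℤ × ℤ × ℤ) × (ℤ × ℤ × ℤ) → ℤ × ℤ × ℤ, ∀ E' : Finset _, (∀ p ∈ E', K.InS (f p)) →
      ((E'.image f).card : ℝ) ≤ 9016 * K.q.divisors.card * (K.R * K.A) := by
    intro f E' h
    apply K.countS _ hbig
    intro s hs
    obtain ⟨p, hp, rfl⟩ := Finset.mem_image.mp hs
    exact h p hp
  set r1 : ℝ := 1024 * K.q.divisors.card * (1 + K.X) with hr1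
  have hr10 : 0 ≤ r1 := by positivity
  have c1 : (E1.card : ℝ) ≤ r1 * (9016 * K.q.divisors.card * (K.R * K.A)) := by
    have hin : ∀ p ∈ E1, K.InS p.2 := fun p hp => by
      rw [hE1, Finset.mem_filter] at hp; exact (hE p hp.1).2.1
    refine (kk_card_fiber E1 (E1.image Prod.snd) Prod.snd (fun a ha => Finset.mem_image_of_mem _ ha) r1 ?_).trans
      (mul_le_mul_of_nonneg_left (hS Prod.snd E1 hin) hr10)
    intro s _
    have e : ((E1.filter (fun p => p.2 = s)).image Prod.fst).card = (E1.filter (fun p => p.2 = s)).card := by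
      apply Finset.card_image_of_injOn
      intro p hp p' hp' h
      simp only [Finset.coe_filter, Set.mem_ofPred_eq] at hp hp'
      exact Prod.ext h (hp.2.trans hp'.2.symm)
    rw [← e]
    apply K.countR _ (K.Dz s)
    intro t ht
    obtain ⟨p, hp, rfl⟩ := Finset.mem_image.mp ht
    simp only [hE1, Finset.mem_filter] at hp
    obtain ⟨⟨hp1, hp2⟩, rfl⟩ := hp
    exact ⟨(hE p hp1).1, hp2, (hE p hp1).2.2⟩
  have c2 : (E2.card : ℝ) ≤ r1 * (9016 * K.q.divisors.card * (K.R * K.A)) := by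
    have hin : ∀ p ∈ E2, K.InS p.1 := fun p hp => by
      rw [hE2, Finset.mem_filter] at hp; exact (hE p hp.1).1
    refine (kk_card_fiber E2 (E2.image Prod.fst) Prod.fst (fun a ha => Finset.mem_image_of_mem _ ha) r1 ?_).trans
      (mul_le_mul_of_nonneg_left (hS Prod.fst E2 hin) hr10)
    intro s _
    have e : ((E2.filter (fun p => p.1 = s)).image Prod.snd).card = (E2.filter (fun p => p.1 = s)).card := by
      apply Finset.card_image_of_injOn
      intro p hp p' hp' h
      simp only [Finset.coe_filter, Set.mem_ofPred_eq] at hp hp'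
      exact Prod.ext (hp.2.trans hp'.2.symm) h
    rw [← e]
    apply K.countR _ (K.Dz s)
    intro t ht
    obtain ⟨p, hp, rfl⟩ := Finset.mem_image.mp ht
    simp only [hE2, Finset.mem_filter] at hp
    obtain ⟨⟨hp1, hp2⟩, rfl⟩ := hp
    exact ⟨(hE p hp1).2.1, hp2, (hE p hp1).2.2.symm⟩
  have hly : 0 ≤ K.l * K.y * K.ρ := by
    have := K.lpos; have := K.hy; have := K.ρpos; positivity
  have c0 : (E0.card : ℝ) ≤ 2 * (1 + 4 * (K.l * K.y * K.ρ)) * (16 * (K.R * K.A)) := by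
    have hin : ∀ s ∈ E0.image Prod.fst, K.InS s ∧ s.2.2 = 0 := fun s hs => by
      obtain ⟨p, hp, rfl⟩ := Finset.mem_image.mp hs
      rw [hE0, Finset.mem_filter] at hp; exact ⟨(hE p hp.1).1, hp.2.1⟩
    refine (kk_card_fiber E0 (E0.image Prod.fst) Prod.fst (fun a ha => Finset.mem_image_of_mem _ ha)
      (2 * (1 + 4 * (K.l * K.y * K.ρ))) ?_).trans
      (mul_le_mul_of_nonneg_left ((K.count0 _ hin).trans (K.est0 h6)) (by positivity))
    intro s _
    have e : ((E0.filter (fun p => p.1 = s)).image Prod.snd).card = (E0.filter (fun p => p.1 = s)).card := by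
      apply Finset.card_image_of_injOn
      intro p hp p' hp' h
      simp only [Finset.coe_filter, Set.mem_ofPred_eq] at hp hp'
      exact Prod.ext (hp.2.trans hp'.2.symm) h
    rw [← e]
    apply K.countR0 _ (K.Dz s)
    intro t ht
    obtain ⟨p, hp, rfl⟩ := Finset.mem_image.mp ht
    simp only [hE0, Finset.mem_filter] at hp
    obtain ⟨⟨hp1, hp2⟩, rfl⟩ := hp
    exact ⟨(hE p hp1).2.1, hp2.2, (hE p hp1).2.2.symm⟩
  have f1 : K.L * (r1 * (9016 * K.q.divisors.card * (K.R * K.A))) ≤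
      9232384 * (K.q.divisors.card : ℝ) ^ 2 * (K.R ^ 2 * (K.A * K.B)) := by
    calc _ = 9232384 * (K.q.divisors.card : ℝ) ^ 2 * (K.L * K.R * (K.A * (1 + K.X))) := by
          rw [hr1]; ring
      _ ≤ 9232384 * (K.q.divisors.card : ℝ) ^ 2 * (K.R * K.R * (K.A * K.B)) := by
          gcongr; linarith
      _ = _ := by ring
  have f0 : K.L * (2 * (1 + 4 * (K.l * K.y * K.ρ)) * (16 * (K.R * K.A))) ≤
      128 * (K.q.divisors.card : ℝ) ^ 2 * (K.R ^ 2 * (K.A * K.B)) := by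
    calc _ = 32 * (K.R * K.A) * (K.L * (1 + 4 * (K.l * K.y * K.ρ))) := by ring
      _ ≤ 32 * (K.R * K.A) * (4 * (K.R * K.B)) := by
          have := K.est1
          gcongr
      _ = 128 * 1 ^ 2 * (K.R ^ 2 * (K.A * K.B)) := by ring
      _ ≤ _ := by
          have : 0 ≤ K.R ^ 2 * (K.A * K.B) := by
            have : 0 < K.A := by linarith
            have : 0 < K.B := by linarith
            positivity
          gcongr
  calc K.L * (E.card : ℝ) ≤ K.L * (E1.card + E2.card + E0.card) := by gcongr
    _ = K.L * E1.card + K.L * E2.card + K.L * E0.card := by ring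
    _ ≤ K.L * (r1 * (9016 * K.q.divisors.card * (K.R * K.A))) + K.L * (r1 * (9016 * K.q.divisors.card * (K.R * K.A)))
        + K.L * (2 * (1 + 4 * (K.l * K.y * K.ρ)) * (16 * (K.R * K.A))) := by gcongr
    _ ≤ _ := by linarith

end KK

namespace KK

def Good (K : KK) (p : ℤ × ℤ × ℤ × ℤ) : Prop := (p.1 : ℝ) ^ 2 ≤ 4 * K.L ^ 2 ∧ K.InS p.2

lemma absx (K : KK) {p : ℤ × ℤ × ℤ × ℤ} (h : K.Good p) : |(p.1 : ℝ)| ≤ 2 * K.L :=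
  abs_le_of_sq_le_sq (by have := h.1; nlinarith) (by linarith [K.hL])

lemma small (K : KK) (hs : 36 * (K.l * K.L ^ 2) < 1) {p : ℤ × ℤ × ℤ × ℤ} (h : K.Good p) (h0 : p ≠ 0) :
    p.1 = 0 ∧ p.2.1 = 0 ∧ p.2.2.2 = 0 ∧ 1 ≤ 2 * (K.l * K.y * K.ρ) ∧ |(p.2.2.1 : ℝ)| ≤ 2 * (K.l * K.y * K.ρ) := by
  have hl1 : (1:ℝ) ≤ K.l := by exact_mod_cast K.hl
  have hl := K.lpos; have hL := K.hL; have hy := K.hy; have hρ := K.ρpos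
  have hL2 : K.L ^ 2 ≤ K.l * K.L ^ 2 := by nlinarith [sq_nonneg K.L]
  have e1 : p.1 = 0 := by
    by_contra hne
    have h1 : (1:ℝ) ≤ (p.1:ℝ) ^ 2 := by exact_mod_cast (by have := pow_pos (abs_pos.mpr hne) 2; rw [sq_abs] at this; omega : (1:ℤ) ≤ p.1 ^ 2)
    linarith [h.1]
  have hD : K.Dz p.2 = 0 := by
    by_contra hne
    have h1 : (1:ℝ) ≤ |(K.Dz p.2 : ℝ)| := by exact_mod_cast Int.one_le_abs hne
    have := K.absDz h.2
    linarith
  have hD' := K.Deq p.2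
  rw [hD] at hD'
  have hU : K.U p.2 ^ 2 = K.V p.2 ^ 2 + K.W p.2 ^ 2 := by
    have : (K.l:ℝ) * (K.V p.2 ^ 2 + K.W p.2 ^ 2 - K.U p.2 ^ 2) = 0 := by rw [← hD']; simp
    rcases mul_eq_zero.mp this with h | h
    · linarith
    · linarith
  have hcm : p.2.1 = 0 ∧ p.2.2.2 = 0 := by
    by_contra hne
    have hne' : 2 * p.2.2.2 ≠ 0 ∨ -p.2.1 ≠ 0 := by
      by_contra hc; push Not at hc; apply hne; constructor <;> omega
    have hm := K.min2 _ _ hne'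
    have e : ((K.q:ℝ) * ((2 * p.2.2.2 : ℤ):ℝ) * K.x + ((-p.2.1 : ℤ) : ℝ)) ^ 2 + (K.q * ((2 * p.2.2.2 : ℤ):ℝ) * K.y) ^ 2
        = K.V p.2 ^ 2 + (K.U p.2 + K.W p.2) ^ 2 := by
      simp only [V, U, W]; push_cast; ring
    rw [e] at hm
    have h2 : K.V p.2 ^ 2 + (K.U p.2 + K.W p.2) ^ 2 ≤ 16 * K.L ^ 2 := by
      have := h.2.1
      have h3 : K.V p.2 ^ 2 + K.W p.2 ^ 2 ≤ 4 * K.L ^ 2 := by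
        have := K.hδ1; nlinarith [sq_nonneg K.L]
      nlinarith [sq_nonneg (K.U p.2 - K.W p.2), sq_nonneg (K.V p.2)]
    have h3 := hm.trans h2
    rw [div_le_iff₀ (by positivity)] at h3
    nlinarith
  obtain ⟨hm, hc⟩ := hcm
  have hb : |(p.2.2.1 : ℝ)| ≤ 2 * (K.l * K.y * K.ρ) := by
    have := K.b_range h.2 hc
    rw [hm] at this
    simp only [Int.cast_zero, zero_mul, mul_zero] at this
    rw [abs_le]; constructor <;> linarith [this.1, this.2]
  refine ⟨e1, hm, hc, ?_, hb⟩
  have hb0 : p.2.2.1 ≠ 0 := by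
    intro hb0
    apply h0
    exact Prod.ext e1 (Prod.ext hm (Prod.ext hb0 hc))
  have : (1:ℝ) ≤ |(p.2.2.1 : ℝ)| := by exact_mod_cast Int.one_le_abs hb0
  linarith

lemma fibneq (K : KK) (D : ℝ) (P : Finset ((ℤ × ℤ × ℤ × ℤ) × (ℤ × ℤ × ℤ × ℤ))) (s1 s2 : ℤ × ℤ × ℤ)
    (hD : ∀ n : ℕ, n ≠ 0 → (n : ℝ) ≤ 8 * (K.l * K.L ^ 2) → (n.divisors.card : ℝ) ≤ D)
    (h1 : K.InS s1) (h2 : K.InS s2) (hne : K.Dz s1 ≠ K.Dz s2)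
    (hP : ∀ p ∈ P, p.1.2 = s1 ∧ p.2.2 = s2 ∧ K.l * p.1.1 ^ 2 - K.Dz p.1.2 = K.l * p.2.1 ^ 2 - K.Dz p.2.2) :
    (P.card : ℝ) ≤ 2 * D := by
  classical
  set n := K.Dz s1 - K.Dz s2 with hn
  have hn0 : n ≠ 0 := sub_ne_zero.mpr hne
  have hnb : (n.natAbs : ℝ) ≤ 8 * (K.l * K.L ^ 2) := by
    rw [Nat.cast_natAbs, Int.cast_abs, hn]
    push_cast
    have := abs_sub (K.Dz s1 : ℝ) (K.Dz s2)
    linarith [K.absDz h1, K.absDz h2]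
  have hdv := hD n.natAbs (by simpa using hn0) hnb
  have hprod : ∀ p ∈ P, (p.1.1 - p.2.1) * (K.l * (p.1.1 + p.2.1)) = n := by
    intro p hp
    obtain ⟨e1, e2, e3⟩ := hP p hp
    rw [e1, e2] at e3
    rw [hn]; linarith
  have hc : P.card ≤ (n.natAbs.divisors ×ˢ (Finset.univ : Finset Bool)).card := by
    refine Finset.card_le_card_of_injOn (fun p => ((p.1.1 - p.2.1).natAbs, decide (0 ≤ p.1.1 - p.2.1))) ?_ ?_
    · intro p hp
      simp only [Finset.coe_product, Finset.coe_univ, Set.mem_prod, Set.mem_univ, and_true, Finset.mem_coe,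
        Nat.mem_divisors]
      refine ⟨?_, by simpa using hn0⟩
      rw [Int.natAbs_dvd_natAbs]
      exact Dvd.intro _ (hprod p hp)
    · intro p hp p' hp' h
      simp only [Prod.mk.injEq, decide_eq_decide] at h
      have hu : p.1.1 - p.2.1 = p'.1.1 - p'.2.1 := by
        rcases Int.natAbs_eq_natAbs_iff.mp h.1 with h' | h'
        · exact h'
        · have := h.2; omega
      have a1 := hprod p hp
      have a2 := hprod p' hp'
      rw [← hu] at a2
      have hu0 : p.1.1 - p.2.1 ≠ 0 := by
        intro h0; rw [h0] at a1; apply hn0; rw [← a1]; ring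
      have hl' : (K.l : ℤ) ≠ 0 := by exact_mod_cast K.hl.ne'
      have hv : p.1.1 + p.2.1 = p'.1.1 + p'.2.1 :=
        mul_left_cancel₀ hl' (mul_left_cancel₀ hu0 (a1.trans a2.symm))
      obtain ⟨b1, b2, -⟩ := hP p hp
      obtain ⟨b1', b2', -⟩ := hP p' hp'
      exact Prod.ext (Prod.ext (by omega) (b1.trans b1'.symm)) (Prod.ext (by omega) (b2.trans b2'.symm))
  rw [Finset.card_product, Finset.card_univ, Fintype.card_bool] at hc
  have : (P.card : ℝ) ≤ n.natAbs.divisors.card * 2 := by exact_mod_cast hc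
  linarith

lemma fibeq (K : KK) (P : Finset ((ℤ × ℤ × ℤ × ℤ) × (ℤ × ℤ × ℤ × ℤ))) (s1 s2 : ℤ × ℤ × ℤ)
    (he : K.Dz s1 = K.Dz s2) (hL : 1 / 2 ≤ K.L)
    (hP : ∀ p ∈ P, K.Good p.1 ∧ p.1.2 = s1 ∧ p.2.2 = s2 ∧
      K.l * p.1.1 ^ 2 - K.Dz p.1.2 = K.l * p.2.1 ^ 2 - K.Dz p.2.2) :
    (P.card : ℝ) ≤ 12 * K.L := by
  classical
  have hl' : (K.l : ℤ) ≠ 0 := by exact_mod_cast K.hl.ne'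
  have hc : P.card ≤ (Finset.Icc ⌈-(2 * K.L)⌉ ⌊-(2 * K.L) + 4 * K.L⌋ ×ˢ (Finset.univ : Finset Bool)).card := by
    refine Finset.card_le_card_of_injOn (fun p => (p.1.1, decide (p.1.1 = p.2.1))) ?_ ?_
    · intro p hp
      have := abs_le.mp (K.absx (hP p hp).1)
      simp only [Finset.coe_product, Finset.coe_univ, Set.mem_prod, Set.mem_univ, and_true, Finset.coe_Icc, Set.mem_Icc]
      exact ⟨Int.ceil_le.mpr this.1, Int.le_floor.mpr (by linarith [this.2])⟩
    · intro p hp p' hp' h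
      simp only [Prod.mk.injEq, decide_eq_decide] at h
      have key : ∀ p ∈ P, p.1.1 = p.2.1 ∨ p.1.1 = - p.2.1 := by
        intro p hp
        obtain ⟨-, e1, e2, e3⟩ := hP p hp
        rw [e1, e2, he] at e3
        exact sq_eq_sq_iff_eq_or_eq_neg.mp (mul_left_cancel₀ hl' (by linarith))
      have k1 := key p hp
      have k2 := key p' hp'
      obtain ⟨-, b1, b2, -⟩ := hP p hp
      obtain ⟨-, b1', b2', -⟩ := hP p' hp'
      have h1 := h.1
      have h2 := h.2
      exact Prod.ext (Prod.ext h1 (b1.trans b1'.symm)) (Prod.ext (by omega) (b2.trans b2'.symm))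
  rw [Finset.card_product, Finset.card_univ, Fintype.card_bool] at hc
  have : (P.card : ℝ) ≤ (Finset.Icc ⌈-(2 * K.L)⌉ ⌊-(2 * K.L) + 4 * K.L⌋).card * 2 := by exact_mod_cast hc
  have h3 := kk_card_Icc (-(2 * K.L)) (4 * K.L) (by linarith)
  linarith

theorem count (K : KK) (D : ℝ) (hD1 : 1 ≤ D)
    (hD : ∀ n : ℕ, n ≠ 0 → (n : ℝ) ≤ 8 * (K.l * K.L ^ 2) → (n.divisors.card : ℝ) ≤ D)
    (P : Finset ((ℤ × ℤ × ℤ × ℤ) × (ℤ × ℤ × ℤ × ℤ)))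
    (hP : ∀ p ∈ P, K.Good p.1 ∧ K.Good p.2 ∧ p.1 ≠ 0 ∧ p.2 ≠ 0 ∧
      K.l * p.1.1 ^ 2 - K.Dz p.1.2 = K.l * p.2.1 ^ 2 - K.Dz p.2.2) :
    (P.card : ℝ) ≤ 400000000 * (K.q.divisors.card : ℝ) ^ 2 * D * (K.l * K.L ^ 2 * (K.A * K.B)) := by
  classical
  have hd := K.one_le_d
  have hR := K.Rpos
  have hR2 := K.Rsq
  have hA := K.A1
  have hAB := K.AB
  have hL := K.hL
  have hA0 : 0 < K.A := by linarith
  have hB0 : 0 < K.B := by linarith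
  have hd2 : (1:ℝ) ≤ (K.q.divisors.card : ℝ) ^ 2 := by nlinarith
  have hdD : (1:ℝ) ≤ (K.q.divisors.card : ℝ) ^ 2 * D := by nlinarith
  rw [← hR2]
  have hM : 0 < K.R ^ 2 * (K.A * K.B) := by positivity
  by_cases hbig : 36 * (K.l * K.L ^ 2) < 1
  · rcases P.eq_empty_or_nonempty with rfl | ⟨p0, hp0⟩
    · simp; positivity
    set z := K.l * K.y * K.ρ with hz
    have hz1 : 1 ≤ 2 * z := (K.small hbig (hP p0 hp0).1 (hP p0 hp0).2.2.1).2.2.2.1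
    have hc : P.card ≤ (Finset.Icc ⌈-(2 * z)⌉ ⌊-(2 * z) + 4 * z⌋ ×ˢ Finset.Icc ⌈-(2 * z)⌉ ⌊-(2 * z) + 4 * z⌋).card := by
      refine Finset.card_le_card_of_injOn (fun p => (p.1.2.2.1, p.2.2.2.1)) ?_ ?_
      · intro p hp
        obtain ⟨g1, g2, g3, g4, -⟩ := hP p hp
        have a1 := abs_le.mp (K.small hbig g1 g3).2.2.2.2
        have a2 := abs_le.mp (K.small hbig g2 g4).2.2.2.2
        simp only [Finset.coe_product, Set.mem_prod, Finset.coe_Icc, Set.mem_Icc]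
        exact ⟨⟨Int.ceil_le.mpr a1.1, Int.le_floor.mpr (by linarith [a1.2])⟩,
          ⟨Int.ceil_le.mpr a2.1, Int.le_floor.mpr (by linarith [a2.2])⟩⟩
      · intro p hp p' hp' h
        simp only [Prod.mk.injEq] at h
        obtain ⟨g1, g2, g3, g4, -⟩ := hP p hp
        obtain ⟨g1', g2', g3', g4', -⟩ := hP p' hp'
        have a1 := K.small hbig g1 g3
        have a2 := K.small hbig g2 g4
        have a1' := K.small hbig g1' g3'
        have a2' := K.small hbig g2' g4'
        exact Prod.ext
          (Prod.ext (a1.1.trans a1'.1.symm) (Prod.ext (a1.2.1.trans a1'.2.1.symm)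
            (Prod.ext h.1 (a1.2.2.1.trans a1'.2.2.1.symm))))
          (Prod.ext (a2.1.trans a2'.1.symm) (Prod.ext (a2.2.1.trans a2'.2.1.symm)
            (Prod.ext h.2 (a2.2.2.1.trans a2'.2.2.1.symm))))
    rw [Finset.card_product] at hc
    have hi := kk_card_Icc (-(2 * z)) (4 * z) (by linarith)
    have hc' : (P.card : ℝ) ≤ (Finset.Icc ⌈-(2 * z)⌉ ⌊-(2 * z) + 4 * z⌋).card * (Finset.Icc ⌈-(2 * z)⌉ ⌊-(2 * z) + 4 * z⌋).card := by
      exact_mod_cast hc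
    have h36 : (P.card : ℝ) ≤ (6 * z) * (6 * z) := by
      refine hc'.trans ?_
      gcongr <;> linarith
    have hzA : z ≤ K.R * K.A := by
      rw [hz, K.lyρ]
      apply mul_le_mul_of_nonneg_left _ hR.le
      have h := K.aux_nonneg; have := K.Xpos; unfold A; linarith [h.1, h.2.1]
    calc (P.card : ℝ) ≤ (6 * z) * (6 * z) := h36
      _ ≤ (6 * (K.R * K.A)) * (6 * (K.R * K.B)) := by
          have : z ≤ K.R * K.B := hzA.trans (by gcongr)
          have hz0 : 0 ≤ 6 * z := by linarith
          gcongr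
      _ = 36 * (K.R ^ 2 * (K.A * K.B)) := by ring
      _ ≤ _ := by
          apply mul_le_mul_of_nonneg_right _ hM.le
          nlinarith
  push Not at hbig
  set S : Finset (ℤ × ℤ × ℤ) := P.image (fun p => p.1.2) ∪ P.image (fun p => p.2.2) with hS
  have hSin : ∀ s ∈ S, K.InS s := by
    intro s hs
    rw [hS, Finset.mem_union, Finset.mem_image, Finset.mem_image] at hs
    rcases hs with ⟨p, hp, rfl⟩ | ⟨p, hp, rfl⟩
    · exact (hP p hp).1.2
    · exact (hP p hp).2.1.2
  have hS1 : ∀ p ∈ P, p.1.2 ∈ S := fun p hp => Finset.mem_union_left _ (Finset.mem_image_of_mem (fun p => p.1.2) hp)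
  have hS2 : ∀ p ∈ P, p.2.2 ∈ S := fun p hp => Finset.mem_union_right _ (Finset.mem_image_of_mem (fun p => p.2.2) hp)
  have hcS := K.countS S hbig hSin
  have hSS : (((S ×ˢ S).card : ℕ) : ℝ) ≤ 81288256 * (K.q.divisors.card : ℝ) ^ 2 * (K.R ^ 2 * (K.A * K.B)) := by
    rw [Finset.card_product]
    push_cast
    calc (S.card : ℝ) * S.card ≤ (9016 * K.q.divisors.card * (K.R * K.A)) * (9016 * K.q.divisors.card * (K.R * K.A)) := by
          gcongr
      _ ≤ (9016 * K.q.divisors.card * (K.R * K.A)) * (9016 * K.q.divisors.card * (K.R * K.B)) := by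
          gcongr
      _ = _ := by ring
  by_cases hLh : K.L < 1 / 2
  · have hz : ∀ p, K.Good p → p.1 = 0 := by
      intro p h
      by_contra hne
      have h1 : (1:ℝ) ≤ |(p.1 : ℝ)| := by exact_mod_cast Int.one_le_abs hne
      have := K.absx h
      linarith
    have hc : P.card ≤ (S ×ˢ S).card := by
      refine Finset.card_le_card_of_injOn (fun p => (p.1.2, p.2.2)) ?_ ?_
      · intro p hp
        exact Finset.mk_mem_product (hS1 p hp) (hS2 p hp)
      · intro p hp p' hp' h
        simp only [Prod.mk.injEq] at h
        exact Prod.ext (Prod.ext ((hz _ (hP p hp).1).trans (hz _ (hP p' hp').1).symm) h.1)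
          (Prod.ext ((hz _ (hP p hp).2.1).trans (hz _ (hP p' hp').2.1).symm) h.2)
    have hc' : (P.card : ℝ) ≤ ((S ×ˢ S).card : ℕ) := by exact_mod_cast hc
    refine hc'.trans (hSS.trans ?_)
    apply mul_le_mul_of_nonneg_right _ hM.le
    nlinarith
  push Not at hLh
  have hsplit := Finset.card_filter_add_card_filter_not (s := P) (fun p => K.Dz p.1.2 = K.Dz p.2.2)
  set P1 := P.filter (fun p => K.Dz p.1.2 = K.Dz p.2.2) with hP1
  set P2 := P.filter (fun p => ¬ K.Dz p.1.2 = K.Dz p.2.2) with hP2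
  have hs : (P.card : ℝ) = (P1.card : ℝ) + P2.card := by exact_mod_cast hsplit.symm
  have c2 : (P2.card : ℝ) ≤ 2 * D * ((S ×ˢ S).card : ℕ) := by
    refine kk_card_fiber P2 (S ×ˢ S) (fun p => (p.1.2, p.2.2)) ?_ _ ?_
    · intro p hp
      rw [hP2, Finset.mem_filter] at hp
      exact Finset.mk_mem_product (hS1 p hp.1) (hS2 p hp.1)
    · rintro ⟨s1, s2⟩ hss
      rw [Finset.mem_product] at hss
      by_cases hne : K.Dz s1 = K.Dz s2
      · have : P2.filter (fun p => (p.1.2, p.2.2) = (s1, s2)) = ∅ := by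
          apply Finset.filter_eq_empty_iff.mpr
          intro p hp h
          rw [hP2, Finset.mem_filter] at hp
          simp only [Prod.mk.injEq] at h
          apply hp.2; rw [h.1, h.2, hne]
        rw [this]; simp; linarith
      · apply K.fibneq D _ s1 s2 hD (hSin _ hss.1) (hSin _ hss.2) hne
        intro p hp
        simp only [hP2, Finset.mem_filter, Prod.mk.injEq] at hp
        exact ⟨hp.2.1, hp.2.2, (hP p hp.1.1).2.2.2.2⟩
  set E := (S ×ˢ S).filter (fun s => K.Dz s.1 = K.Dz s.2) with hE
  have c1 : (P1.card : ℝ) ≤ 12 * K.L * E.card := by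
    refine kk_card_fiber P1 E (fun p => (p.1.2, p.2.2)) ?_ _ ?_
    · intro p hp
      rw [hP1, Finset.mem_filter] at hp
      rw [hE, Finset.mem_filter]
      exact ⟨Finset.mk_mem_product (hS1 p hp.1) (hS2 p hp.1), hp.2⟩
    · rintro ⟨s1, s2⟩ hss
      rw [hE, Finset.mem_filter] at hss
      apply K.fibeq _ s1 s2 hss.2 hLh
      intro p hp
      simp only [hP1, Finset.mem_filter, Prod.mk.injEq] at hp
      exact ⟨(hP p hp.1.1).1, hp.2.1, hp.2.2, (hP p hp.1.1).2.2.2.2⟩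
  have cE := K.countE E hbig (by
    intro p hp
    rw [hE, Finset.mem_filter, Finset.mem_product] at hp
    exact ⟨hSin _ hp.1.1, hSin _ hp.1.2, hp.2⟩)
  set d2 := (K.q.divisors.card : ℝ) ^ 2
  set M := K.R ^ 2 * (K.A * K.B)
  have hdM : d2 * M ≤ d2 * D * M := by
    have : 0 ≤ d2 * M := by positivity
    nlinarith
  calc (P.card : ℝ) = P1.card + P2.card := hs
    _ ≤ 12 * (18464896 * d2 * M) + 2 * D * (81288256 * d2 * M) := by
        have : 2 * D * (((S ×ˢ S).card : ℕ) : ℝ) ≤ 2 * D * (81288256 * d2 * M) := by gcongr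
        linarith
    _ = 221578752 * (d2 * M) + 162576512 * (d2 * D * M) := by ring
    _ ≤ 400000000 * (d2 * D * M) := by nlinarith
    _ = _ := by ring

lemma finite (K : KK) : {s | K.InS s}.Finite := by
  have hl := K.lpos; have hq := K.qpos; have hy := K.hy; have hρ := K.ρpos; have hL := K.hL
  set c0 : ℝ := (2 * K.L + 2 * K.ρ) / (2 * (K.y * K.q)) with hc0
  set m0 : ℝ := 2 * K.ρ + 2 * |K.x| * K.q * c0 with hm0
  set b0 : ℝ := K.l * (K.y * (2 * K.ρ + 2 * K.L) + m0 * |K.x| + K.q * c0 * K.x ^ 2) with hb0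
  have hc00 : 0 ≤ c0 := by positivity
  have hfin : ∀ B : ℝ, {n : ℤ | |(n:ℝ)| ≤ B}.Finite := by
    intro B
    apply (Set.finite_Icc (⌈-B⌉) ⌊B⌋).subset
    intro n hn
    rw [Set.mem_ofPred_eq] at hn
    have := abs_le.mp hn
    exact ⟨Int.ceil_le.mpr this.1, Int.le_floor.mpr this.2⟩
  apply ((hfin m0).prod ((hfin b0).prod (hfin c0))).subset
  intro s hs
  have hV := K.absV hs; have hW := K.absW hs; have hU := K.absU hs
  have hc : |(s.2.2 : ℝ)| ≤ c0 := by
    have e : (s.2.2 : ℝ) = (K.U s + K.W s) / (2 * (K.y * K.q)) := by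
      simp only [U, W]; field_simp; ring
    rw [e, abs_div, abs_of_pos (by positivity : 0 < 2 * (K.y * K.q)), hc0]
    gcongr
    exact (abs_add_le _ _).trans (by linarith)
  have hm : |(s.1 : ℝ)| ≤ m0 := by
    have e : (s.1 : ℝ) = K.V s + 2 * K.x * K.q * s.2.2 := by simp only [V]; ring
    rw [e, hm0]
    refine (abs_add_le _ _).trans ?_
    rw [abs_mul, abs_mul, abs_mul, abs_of_pos hq, abs_two]
    gcongr
  refine ⟨hm, ?_, hc⟩
  have hT : |K.T s| ≤ 2 * K.ρ + 2 * K.L := by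
    have e : K.T s = (K.W s - K.U s) / 2 := by simp only [W, U]; ring
    rw [e, abs_div, abs_two]
    have := abs_sub (K.W s) (K.U s)
    linarith
  have e : (s.2.1 : ℝ) = K.l * (K.y * K.T s - s.1 * K.x + K.q * s.2.2 * K.x ^ 2) := by
    simp only [T]; field_simp; ring
  show |(s.2.1 : ℝ)| ≤ b0
  rw [e, hb0, abs_mul, abs_of_pos hl]
  gcongr
  refine (abs_add_le _ _).trans ?_
  have h1 : |K.y * K.T s - s.1 * K.x| ≤ K.y * (2 * K.ρ + 2 * K.L) + m0 * |K.x| := by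
    refine (abs_sub _ _).trans ?_
    rw [abs_mul, abs_mul, abs_of_pos hy]
    gcongr
  have h2 : |K.q * s.2.2 * K.x ^ 2| ≤ K.q * c0 * K.x ^ 2 := by
    rw [abs_mul, abs_mul, abs_of_pos hq, abs_of_nonneg (sq_nonneg K.x)]
    gcongr
  linarith

lemma finiteG (K : KK) : {p | K.Good p}.Finite := by
  apply ((Set.finite_Icc (⌈-(2 * K.L)⌉) ⌊2 * K.L⌋).prod K.finite).subset
  intro p hp
  have := abs_le.mp (K.absx hp)
  exact ⟨⟨Int.ceil_le.mpr this.1, Int.le_floor.mpr this.2⟩, hp.2⟩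

end KK

noncomputable def kkmat (K : KK) (p : ℤ × ℤ × ℤ × ℤ) : M2 :=
  !![((p.1 : ℝ) + p.2.1) / 2, (p.2.2.1 : ℝ) / K.l; (p.2.2.2 : ℝ) * K.q, ((p.1 : ℝ) - p.2.1) / 2]

lemma kk_inv2 (h : M2) (hh : h.det = 1) : h⁻¹ = !![h 1 1, - h 0 1; - h 1 0, h 0 0] := by
  rw [Matrix.inv_def, hh, Matrix.adjugate_fin_two]; simp

set_option maxHeartbeats 1000000 in
lemma kk_transfer (K : KK) (h : M2) (hh : h.det = 1) (hy : K.y = 1 / (h 1 0 ^ 2 + h 1 1 ^ 2))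
    (hx : K.x = (h 0 0 * h 1 0 + h 0 1 * h 1 1) * K.y) (N : ℕ) (hN : N = K.q * K.l) (γ : M2)
    (hγ : h * γ * h⁻¹ ∈ Rlat N K.l) (hΩ : γ ∈ OmegaStar K.δ K.L) :
    ∃ p : ℤ × ℤ × ℤ × ℤ, K.Good p ∧ p ≠ 0 ∧
      4 * K.l * γ.det = K.l * (p.1 : ℝ) ^ 2 - K.Dz p.2 ∧ γ = h⁻¹ * kkmat K p * h := by
  have hl := K.lpos; have hq := K.qpos; have hy0 := K.hy
  have hu : IsUnit h.det := by rw [hh]; exact isUnit_one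
  obtain ⟨M, hM⟩ : ∃ M, M = h * γ * h⁻¹ := ⟨_, rfl⟩
  rw [← hM] at hγ
  have hγM : γ = h⁻¹ * M * h := by
    rw [hM, Matrix.mul_assoc, Matrix.mul_assoc, Matrix.mul_assoc, Matrix.nonsing_inv_mul _ hu, Matrix.mul_one,
      ← Matrix.mul_assoc, Matrix.nonsing_inv_mul _ hu, Matrix.one_mul]
  obtain ⟨⟨a, ha⟩, ⟨b, hb⟩, ⟨c, hc⟩, ⟨d, hd⟩⟩ := hγ
  have hc' : M 1 0 = c * K.q := by
    rw [hc, hN]; push_cast; field_simp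
  have hMp : M = kkmat K (a + d, a - d, b, c) := by
    ext i j
    fin_cases i <;> fin_cases j <;> simp [kkmat, ha, hb, hc', hd] <;> ring
  refine ⟨(a + d, a - d, b, c), ?_⟩
  set p : ℤ × ℤ × ℤ × ℤ := (a + d, a - d, b, c) with hp
  have hdet : γ.det = M.det := by
    rw [hγM, Matrix.det_mul, Matrix.det_mul, Matrix.det_nonsing_inv, hh]; simp
  have hdetM : 4 * K.l * M.det = K.l * (p.1 : ℝ) ^ 2 - K.Dz p.2 := by
    rw [Matrix.det_fin_two, ha, hb, hc', hd]
    simp only [hp, KK.Dz]; push_cast; field_simp; ring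
  have hD := K.Deq p.2
  have hn : 0 < h 1 0 ^ 2 + h 1 1 ^ 2 := kk_den_pos h hh
  have h1 : h 0 0 * h 1 1 - h 0 1 * h 1 0 = 1 := by rw [← Matrix.det_fin_two]; exact hh
  have hinv := kk_inv2 h hh
  clear hM
  have g00 : γ 0 0 = h 1 1 * (M 0 0 * h 0 0 + M 0 1 * h 1 0) - h 0 1 * (M 1 0 * h 0 0 + M 1 1 * h 1 0) := by
    rw [hγM, hinv, Matrix.mul_apply, Fin.sum_univ_two, Matrix.mul_apply, Matrix.mul_apply, Fin.sum_univ_two, Fin.sum_univ_two]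
    simp only [Matrix.of_apply, Matrix.cons_val', Matrix.cons_val_zero, Matrix.cons_val_one, Matrix.cons_val_fin_one]; ring
  have g01 : γ 0 1 = h 1 1 * (M 0 0 * h 0 1 + M 0 1 * h 1 1) - h 0 1 * (M 1 0 * h 0 1 + M 1 1 * h 1 1) := by
    rw [hγM, hinv, Matrix.mul_apply, Fin.sum_univ_two, Matrix.mul_apply, Matrix.mul_apply, Fin.sum_univ_two, Fin.sum_univ_two]
    simp only [Matrix.of_apply, Matrix.cons_val', Matrix.cons_val_zero, Matrix.cons_val_one, Matrix.cons_val_fin_one]; ring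
  have g10 : γ 1 0 = - h 1 0 * (M 0 0 * h 0 0 + M 0 1 * h 1 0) + h 0 0 * (M 1 0 * h 0 0 + M 1 1 * h 1 0) := by
    rw [hγM, hinv, Matrix.mul_apply, Fin.sum_univ_two, Matrix.mul_apply, Matrix.mul_apply, Fin.sum_univ_two, Fin.sum_univ_two]
    simp only [Matrix.of_apply, Matrix.cons_val', Matrix.cons_val_zero, Matrix.cons_val_one, Matrix.cons_val_fin_one]; ring
  have g11 : γ 1 1 = - h 1 0 * (M 0 0 * h 0 1 + M 0 1 * h 1 1) + h 0 0 * (M 1 0 * h 0 1 + M 1 1 * h 1 1) := by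
    rw [hγM, hinv, Matrix.mul_apply, Fin.sum_univ_two, Matrix.mul_apply, Matrix.mul_apply, Fin.sum_univ_two, Fin.sum_univ_two]
    simp only [Matrix.of_apply, Matrix.cons_val', Matrix.cons_val_zero, Matrix.cons_val_one, Matrix.cons_val_fin_one]; ring
  have htr : γ 0 0 + γ 1 1 = (p.1 : ℝ) := by
    have : γ 0 0 + γ 1 1 = (M 0 0 + M 1 1) * (h 0 0 * h 1 1 - h 0 1 * h 1 0) := by rw [g00, g11]; ring
    rw [this, h1, ha, hd, hp]; push_cast; ring
  have hU : K.U p.2 = γ 1 0 - γ 0 1 := by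
    have e1 : γ 1 0 - γ 0 1 = M 1 0 * (h 0 0 ^ 2 + h 0 1 ^ 2) - M 0 1 * (h 1 0 ^ 2 + h 1 1 ^ 2)
        - (M 0 0 - M 1 1) * (h 0 0 * h 1 0 + h 0 1 * h 1 1) := by rw [g10, g01]; ring
    rw [e1, ha, hb, hc', hd]
    simp only [KK.U, KK.T, hp]
    rw [hx]
    have e2 : (h 0 0 * h 1 0 + h 0 1 * h 1 1) ^ 2 = (h 1 0 ^ 2 + h 1 1 ^ 2) * (h 0 0 ^ 2 + h 0 1 ^ 2) - 1 := by
      linear_combination (-(h 0 0 * h 1 1 - h 0 1 * h 1 0) - 1) * h1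
    have hyn : K.y * (h 1 0 ^ 2 + h 1 1 ^ 2) = 1 := by rw [hy]; field_simp
    generalize h 1 0 ^ 2 + h 1 1 ^ 2 = n at *
    generalize h 0 0 ^ 2 + h 0 1 ^ 2 = n' at *
    generalize h 0 0 * h 1 0 + h 0 1 * h 1 1 = s at *
    have : n = 1 / K.y := by field_simp; linarith
    push_cast
    have hs : K.q * (c:ℝ) * (s * K.y) ^ 2 = K.q * c * (K.y * n' - K.y ^ 2) := by
      rw [mul_pow, e2]; linear_combination (K.q * c * K.y * n') * hyn
    rw [hs, this]
    field_simp
    ring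
  have hP : 2 * Pfun γ = (p.1 : ℝ) ^ 2 - 2 * γ.det + K.U p.2 ^ 2 := by
    rw [← htr, hU, Matrix.det_fin_two, Pfun]; ring
  have hVW : K.V p.2 ^ 2 + K.W p.2 ^ 2 = K.U p.2 ^ 2 + (p.1 : ℝ) ^ 2 - 4 * γ.det := by
    rw [← hdet] at hdetM
    have : (K.l : ℝ) * (K.V p.2 ^ 2 + K.W p.2 ^ 2) = K.l * (K.U p.2 ^ 2 + (p.1 : ℝ) ^ 2 - 4 * γ.det) := by
      linarith
    exact mul_left_cancel₀ hl.ne' this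
  obtain ⟨⟨o1, o2⟩, hne⟩ := hΩ
  have hγp : γ = h⁻¹ * kkmat K p * h := by rw [← hMp]; exact hγM
  have s1 := sq_nonneg (K.V p.2)
  have s2 := sq_nonneg (K.W p.2)
  have s3 := sq_nonneg (K.U p.2)
  have s4 := sq_nonneg (p.1 : ℝ)
  have hfin : 4 * K.l * γ.det = K.l * (p.1 : ℝ) ^ 2 - K.Dz p.2 := by rw [hdet]; exact hdetM
  clear_value p
  clear hMp ha hb hc hc' hd g00 g01 g10 g11 htr hU hdetM hD
  refine ⟨⟨?_, ?_, ?_⟩, ?_, hfin, hγp⟩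
  · linarith
  · linarith
  · linarith
  · intro h0
    apply hne
    have : kkmat K 0 = 0 := by
      ext i j; fin_cases i <;> fin_cases j <;> simp [kkmat]
    rw [hγp, h0, this]; simp

theorem kk_main (K : KK) (h : M2) (hh : h.det = 1) (hy : K.y = 1 / (h 1 0 ^ 2 + h 1 1 ^ 2))
    (hx : K.x = (h 0 0 * h 1 0 + h 0 1 * h 1 1) * K.y) (N : ℕ) (hN : N = K.q * K.l)
    (D : ℝ) (hD1 : 1 ≤ D)
    (hD : ∀ n : ℕ, n ≠ 0 → (n : ℝ) ≤ 8 * (K.l * K.L ^ 2) → (n.divisors.card : ℝ) ≤ D)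
    (Y : Set (M2 × M2)) (hY : ∀ p ∈ Y, (h * p.1 * h⁻¹ ∈ Rlat N K.l ∧ p.1 ∈ OmegaStar K.δ K.L) ∧
      (h * p.2 * h⁻¹ ∈ Rlat N K.l ∧ p.2 ∈ OmegaStar K.δ K.L) ∧ p.1.det = p.2.det) :
    Y.Finite ∧ (Y.ncard : ℝ) ≤ 400000000 * (K.q.divisors.card : ℝ) ^ 2 * D * (K.l * K.L ^ 2 * (K.A * K.B)) := by
  classical
  let G : Set ((ℤ × ℤ × ℤ × ℤ) × (ℤ × ℤ × ℤ × ℤ)) := {p | K.Good p.1 ∧ K.Good p.2 ∧ p.1 ≠ 0 ∧ p.2 ≠ 0 ∧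
      K.l * p.1.1 ^ 2 - K.Dz p.1.2 = K.l * p.2.1 ^ 2 - K.Dz p.2.2}
  have hGf : G.Finite := (K.finiteG.prod K.finiteG).subset (fun p hp => ⟨hp.1, hp.2.1⟩)
  let Φ : (ℤ × ℤ × ℤ × ℤ) × (ℤ × ℤ × ℤ × ℤ) → M2 × M2 :=
    fun p => (h⁻¹ * kkmat K p.1 * h, h⁻¹ * kkmat K p.2 * h)
  have hsub : Y ⊆ Φ '' G := by
    intro p hp
    obtain ⟨⟨a1, a2⟩, ⟨b1, b2⟩, hdet⟩ := hY p hp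
    obtain ⟨u, u1, u2, u3, u4⟩ := kk_transfer K h hh hy hx N hN p.1 a1 a2
    obtain ⟨v, v1, v2, v3, v4⟩ := kk_transfer K h hh hy hx N hN p.2 b1 b2
    refine ⟨(u, v), ⟨u1, v1, u2, v2, ?_⟩, Prod.ext u4.symm v4.symm⟩
    rw [hdet, v3] at u3
    exact_mod_cast u3.symm
  have hfin : (Φ '' G).Finite := hGf.image Φ
  refine ⟨hfin.subset hsub, ?_⟩
  have h1 : Y.ncard ≤ hGf.toFinset.card := by
    rw [← Set.ncard_eq_toFinset_card G hGf]
    exact (Set.ncard_le_ncard hsub hfin).trans (Set.ncard_image_le hGf)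
  have h2 := K.count D hD1 hD hGf.toFinset (fun p hp => (hGf.mem_toFinset.mp hp))
  have h1' : (Y.ncard : ℝ) ≤ hGf.toFinset.card := by exact_mod_cast h1
  exact h1'.trans h2

lemma kk_exists (N ℓ : ℕ) (δ L : ℝ) (hsf : Squarefree N) (hN : 0 < N) (hℓ : 0 < ℓ) (hℓN : ℓ ∣ N)
    (hδ : 0 < δ) (hδ1 : δ ≤ 1) (hL : 0 < L) (h : M2) (hh : h.det = 1)
    (hred : ∀ σ ∈ AtkinLehner N, 1 / ((σ * h) 1 0 ^ 2 + (σ * h) 1 1 ^ 2) ≤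
        2 * (1 / (h 1 0 ^ 2 + h 1 1 ^ 2))) :
    ∃ K : KK, K.l = ℓ ∧ K.δ = δ ∧ K.L = L ∧ N = K.q * K.l ∧ K.y = 1 / (h 1 0 ^ 2 + h 1 1 ^ 2) ∧
      K.x = (h 0 0 * h 1 0 + h 0 1 * h 1 1) * K.y := by
  obtain ⟨q, rfl⟩ := hℓN
  have hq : 0 < q := Nat.pos_of_mul_pos_left hN
  have hn : 0 < h 1 0 ^ 2 + h 1 1 ^ 2 := kk_den_pos h hh
  have hqr : (0:ℝ) < q := by exact_mod_cast hq
  have hlr : (0:ℝ) < ℓ := by exact_mod_cast hℓ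
  refine ⟨⟨q, ℓ, (h 0 0 * h 1 0 + h 0 1 * h 1 1) * (1 / (h 1 0 ^ 2 + h 1 1 ^ 2)), 1 / (h 1 0 ^ 2 + h 1 1 ^ 2), δ, L,
    hq, hℓ, hsf.squarefree_of_dvd (Dvd.intro_left _ rfl), (Nat.coprime_of_squarefree_mul hsf).symm,
    by positivity, hδ, hδ1, hL, ?_, ?_⟩, rfl, rfl, rfl, by simp [mul_comm], rfl, rfl⟩
  · intro c d hcd
    obtain ⟨k, r, Q, hk, hQ, hr, hQr, -, hle⟩ := kk_min (ℓ * q) hN hsf h hh hred _ _ rfl rfl c d hcd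
    refine le_trans ?_ hle
    have hQN : (Q:ℝ) ≤ q * ℓ := by
      have : Q ≤ ℓ * q := by rw [← hQr]; exact Nat.le_mul_of_pos_right _ hr
      have h' : (Q:ℝ) ≤ ℓ * q := by exact_mod_cast this
      linarith
    have hQ' : (0:ℝ) < Q := by exact_mod_cast hQ
    have hk' : (1:ℝ) ≤ k := by exact_mod_cast hk
    have : (1:ℝ) ≤ (k:ℝ) ^ 2 := by nlinarith
    gcongr
  · intro c d hcd
    obtain ⟨k, r, Q, hk, hQ, hr, hQr, hdv, hle⟩ := kk_min (ℓ * q) hN hsf h hh hred _ _ rfl rfl (q * c) d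
      (hcd.imp (fun h' => mul_ne_zero (by exact_mod_cast hq.ne') h') id)
    push_cast at hle
    refine le_trans ?_ hle
    have h1 := hdv q (Dvd.intro_left _ rfl) (Dvd.intro _ rfl)
    have h2 : Q ≤ k * ℓ := by
      have : Q * r ≤ (k * ℓ) * r := by rw [hQr]; nlinarith
      exact Nat.le_of_mul_le_mul_right this hr
    have hQ' : (0:ℝ) < Q := by exact_mod_cast hQ
    have hk' : (1:ℝ) ≤ k := by exact_mod_cast hk
    have h3 : (Q:ℝ) ≤ k * ℓ := by exact_mod_cast h2
    rw [div_le_div_iff₀ (by positivity) (by positivity)]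
    nlinarith [mul_pos hlr (by linarith : (0:ℝ) < k), mul_nonneg hlr.le (mul_nonneg (by linarith : (0:ℝ) ≤ k) (by linarith : (0:ℝ) ≤ (k:ℝ) - 1))]

/-- Second-moment count for R(ℓ;g) ∩ Ω⋆(δ,L). -/
theorem stmt0 (ε : ℝ) (hε : 0 < ε) : ∃ C : ℝ, 0 < C ∧
    ∀ (N ℓ : ℕ) (g : M2) (δ L : ℝ), Squarefree N → 0 < N → 0 < ℓ → ℓ ∣ N →
    g.det = 1 → 0 < δ → δ ≤ 1 → 0 < L →
    {p : M2 × M2 | p.1 ∈ Rconj N ℓ g ∩ OmegaStar δ L ∧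
        p.2 ∈ Rconj N ℓ g ∩ OmegaStar δ L ∧ p.1.det = p.2.det}.Finite ∧
    (({p : M2 × M2 | p.1 ∈ Rconj N ℓ g ∩ OmegaStar δ L ∧
        p.2 ∈ Rconj N ℓ g ∩ OmegaStar δ L ∧ p.1.det = p.2.det}.ncard : ℝ) ≤
      C * ((N : ℝ) * (1 + L)) ^ ε * ((ℓ : ℝ) * L ^ 2) *
        (1 + Real.sqrt ℓ * Hgt N g * Real.sqrt δ + Real.sqrt ℓ * Hgt N g * δ * L
          + (ℓ : ℝ) ^ 2 / N * δ * L ^ 2) *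
        (1 + Real.sqrt ℓ * Hgt N g * Real.sqrt δ + Real.sqrt ℓ * Hgt N g * Real.sqrt δ * L
          + (ℓ : ℝ) ^ 2 / N * δ * L ^ 2)) := by
  obtain ⟨C0, hC0, hdiv⟩ := kk_divisor_bound (ε / 3) (by positivity)
  have hC0p : 0 < C0 := by linarith
  refine ⟨400000000 * C0 ^ 3 * 8 ^ (ε / 3), by positivity, ?_⟩
  intro N ℓ g δ L hsf hN hℓ hℓN hg hδ hδ1 hL
  obtain ⟨τ, hτ, hyH, hred⟩ := kk_reduce N hN g hg
  have hh : (τ * g).det = 1 := by rw [Matrix.det_mul, hτ.1, hg, one_mul]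
  obtain ⟨K, rfl, rfl, rfl, hNq, hy, hx⟩ := kk_exists N ℓ δ L hsf hN hℓ hℓN hδ hδ1 hL (τ * g) hh hred
  have hN1 : (1:ℝ) ≤ N := by exact_mod_cast hN
  have hNr : (0:ℝ) < N := by linarith
  have hlN : (K.l : ℝ) ≤ N := by exact_mod_cast Nat.le_of_dvd hN hℓN
  have hqN : (K.q : ℝ) ≤ N := by
    exact_mod_cast Nat.le_of_dvd hN (Dvd.intro _ hNq.symm)
  set Z : ℝ := (N : ℝ) * (1 + K.L) with hZ
  have hZ1 : 1 ≤ Z := by rw [hZ]; nlinarith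
  have hη : 0 < ε / 3 := by positivity
  have hlp := K.lpos
  have hqp := K.qpos
  set D : ℝ := C0 * (8 * (N * (1 + K.L) ^ 2)) ^ (ε / 3) with hDdef
  have hbase : 1 ≤ 8 * ((N:ℝ) * (1 + K.L) ^ 2) := by
    have : 1 ≤ (1 + K.L) ^ 2 := by nlinarith
    nlinarith
  have hD1 : 1 ≤ D := by
    have := Real.one_le_rpow hbase hη.le
    rw [hDdef]; nlinarith
  have hDb : ∀ n : ℕ, n ≠ 0 → (n : ℝ) ≤ 8 * (K.l * K.L ^ 2) → (n.divisors.card : ℝ) ≤ D := by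
    intro n hn hle
    refine (hdiv n hn).trans ?_
    rw [hDdef]
    have : (n:ℝ) ≤ 8 * ((N:ℝ) * (1 + K.L) ^ 2) := by
      refine hle.trans ?_
      have : K.L ≤ 1 + K.L := by linarith
      gcongr
    gcongr
  have main := kk_main K (τ * g) hh hy hx N hNq D hD1 hDb
    {p : M2 × M2 | p.1 ∈ Rconj N K.l g ∩ OmegaStar K.δ K.L ∧
        p.2 ∈ Rconj N K.l g ∩ OmegaStar K.δ K.L ∧ p.1.det = p.2.det} ?_
  · refine ⟨main.1, main.2.trans ?_⟩
    have hXe : (K.l : ℝ) ^ 2 / N * K.δ * K.L ^ 2 = K.X := by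
      have : (N:ℝ) = K.q * K.l := by exact_mod_cast hNq
      rw [this, KK.X]; field_simp
    rw [hXe]
    rw [← hy] at hyH
    have hy0 := K.hy
    have hX := K.Xpos
    have hA : K.A ≤ 1 + √K.l * Hgt N g * √K.δ + √K.l * Hgt N g * K.δ * K.L + K.X := by
      unfold KK.A; gcongr
    have hB : K.B ≤ 1 + √K.l * Hgt N g * √K.δ + √K.l * Hgt N g * √K.δ * K.L + K.X := by
      unfold KK.B; gcongr
    have hA0 : 0 < K.A := by linarith [K.A1]
    have hB0 : 0 < K.B := by linarith [K.A1, K.AB]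
    have hd : (K.q.divisors.card : ℝ) ≤ C0 * (N:ℝ) ^ (ε / 3) := by
      refine (hdiv K.q K.hq.ne').trans ?_
      gcongr
    have hfac : (K.q.divisors.card : ℝ) ^ 2 * D ≤ C0 ^ 3 * 8 ^ (ε / 3) * Z ^ ε := by
      have e1 : Z ^ ε = (N:ℝ) ^ (ε / 3) * (N:ℝ) ^ (ε / 3) * (N:ℝ) ^ (ε / 3) *
          ((1 + K.L) ^ (ε / 3) * (1 + K.L) ^ (ε / 3)) * (1 + K.L) ^ (ε / 3) := by
        rw [hZ, Real.mul_rpow (by positivity) (by positivity), ← Real.rpow_add (by positivity),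
          ← Real.rpow_add (by positivity), ← Real.rpow_add (by positivity)]
        rw [mul_assoc, ← Real.rpow_add (by positivity)]
        congr 2 <;> ring
      have e2 : D = C0 * (8 ^ (ε / 3) * ((N:ℝ) ^ (ε / 3) * ((1 + K.L) ^ (ε / 3) * (1 + K.L) ^ (ε / 3)))) := by
        rw [hDdef, Real.mul_rpow (by positivity) (by positivity), Real.mul_rpow (by positivity) (by positivity),
          sq, Real.mul_rpow (by positivity) (by positivity)]
      have e3 : (1:ℝ) ≤ (1 + K.L) ^ (ε / 3) := Real.one_le_rpow (by linarith) hη.le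
      have hD0 : 0 ≤ D := by linarith
      calc (K.q.divisors.card : ℝ) ^ 2 * D ≤ (C0 * (N:ℝ) ^ (ε / 3)) ^ 2 * D := by gcongr
        _ = (C0 ^ 3 * 8 ^ (ε / 3) * ((N:ℝ) ^ (ε / 3) * (N:ℝ) ^ (ε / 3) * (N:ℝ) ^ (ε / 3) *
          ((1 + K.L) ^ (ε / 3) * (1 + K.L) ^ (ε / 3)))) * 1 := by rw [e2]; ring
        _ ≤ (C0 ^ 3 * 8 ^ (ε / 3) * ((N:ℝ) ^ (ε / 3) * (N:ℝ) ^ (ε / 3) * (N:ℝ) ^ (ε / 3) *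
          ((1 + K.L) ^ (ε / 3) * (1 + K.L) ^ (ε / 3)))) * (1 + K.L) ^ (ε / 3) := by gcongr
        _ = _ := by rw [e1]; ring
    calc _ = 400000000 * ((K.q.divisors.card : ℝ) ^ 2 * D) * (K.l * K.L ^ 2) * K.A * K.B := by ring
      _ ≤ 400000000 * (C0 ^ 3 * 8 ^ (ε / 3) * Z ^ ε) * (K.l * K.L ^ 2) *
          (1 + √K.l * Hgt N g * √K.δ + √K.l * Hgt N g * K.δ * K.L + K.X) *
          (1 + √K.l * Hgt N g * √K.δ + √K.l * Hgt N g * √K.δ * K.L + K.X) := by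
          have : 0 < Z := by linarith
          have hP0 : 0 ≤ 1 + √K.l * Hgt N g * √K.δ + √K.l * Hgt N g * K.δ * K.L + K.X := hA0.le.trans hA
          have hQ0 : 0 ≤ 400000000 * (C0 ^ 3 * 8 ^ (ε / 3) * Z ^ ε) * (K.l * K.L ^ 2) *
            (1 + √K.l * Hgt N g * √K.δ + √K.l * Hgt N g * K.δ * K.L + K.X) := mul_nonneg (by positivity) hP0
          gcongr
      _ = _ := by ring
  · have hconj : ∀ γ : M2, γ ∈ Rconj N K.l g → τ * g * γ * (τ * g)⁻¹ ∈ Rlat N K.l := by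
      intro γ hγ
      have := kk_conj N K.l hN hℓ hℓN τ _ hτ hγ
      rw [Matrix.mul_inv_rev]
      simpa only [Matrix.mul_assoc] using this
    intro p hp
    obtain ⟨h1, h2, h3⟩ := hp
    exact ⟨⟨hconj _ h1.1, h1.2⟩, ⟨hconj _ h2.1, h2.2⟩, h3⟩
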